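/- arXiv:2305.03818 — 2 statements merged into one kernel-verified Lean document; each statement's English description precedes it below -/
import Mathlib

section
/- Let q ≥ 0, 1 ≤ t ≤ 2^q and k ≥ 2 be integers, let m = 2^{q+1} − t and d = 2^q·(k+1) − t. Let F_1, …, F_m be finite families of nonempty compact convex subsets of ℝ^d such that no four members of any single family F_i are pairwise disjoint. Then there exist k hyperplanes H_1, …, H_k in ℝ^d such that for every pair of indices 1 ≤ i < j ≤ k, the union H_i ∪ H_j intersects every member of every family F_r; that is, every F_r is pierced by any two of the k hyperplanes. -/
open RealInnerProductSpace

noncomputable section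

/-- The hyperplane `{x | ⟪a, x⟫ = b}` in `ℝ^d`. -/
def hyperplane {d : ℕ} (a : EuclideanSpace ℝ (Fin d)) (b : ℝ) :
    Set (EuclideanSpace ℝ (Fin d)) :=
  {x | ⟪a, x⟫ = b}

namespace PH

open MvPolynomial Finset

lemma perm_avg {k : ℕ} (ρ σ : Equiv.Perm (Fin k)) (b : Fin k → ℕ)
    (hb : ∀ i, 2 * b i = (ρ i : ℕ) + (σ i : ℕ)) (hinj : Function.Injective b) : σ = ρ := by
  have hlt : ∀ i, b i < k := fun i => by
    have := hb i; have h1 := (ρ i).2; have h2 := (σ i).2; omega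
  have hinj' : Function.Injective (fun i => (⟨b i, hlt i⟩ : Fin k)) := by
    intro i j h; apply hinj; simpa using h
  let β : Equiv.Perm (Fin k) := Equiv.ofBijective _ (Finite.injective_iff_bijective.mp hinj')
  have key : ∀ τ : Equiv.Perm (Fin k), ∑ i, ((τ i : ℕ) : ℤ) ^ 2 = ∑ i : Fin k, ((i : ℕ) : ℤ) ^ 2 :=
    fun τ => Equiv.sum_comp τ (fun i : Fin k => ((i : ℕ) : ℤ) ^ 2)
  have hβ : ∀ i, ((β i : Fin k) : ℕ) = b i := fun i => rfl
  have hz : ∑ i, (((ρ i : ℕ) : ℤ) - (σ i : ℕ)) ^ 2 = 0 := by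
    have : ∀ i, (((ρ i : ℕ) : ℤ) - (σ i : ℕ)) ^ 2
        = 2 * ((ρ i : ℕ) : ℤ) ^ 2 + 2 * ((σ i : ℕ) : ℤ) ^ 2 - 4 * ((β i : ℕ) : ℤ) ^ 2 := by
      intro i
      have h : 2 * ((b i : ℕ) : ℤ) = (ρ i : ℕ) + (σ i : ℕ) := by exact_mod_cast hb i
      rw [hβ i]
      linear_combination (2 * ((b i : ℕ) : ℤ) + ((ρ i : ℕ) + (σ i : ℕ))) * h
    simp_rw [this, sum_sub_distrib, sum_add_distrib, ← mul_sum, key]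
    ring
  rw [sum_eq_zero_iff_of_nonneg (fun i _ => sq_nonneg _)] at hz
  ext i
  have := hz i (mem_univ i)
  have h2 := pow_eq_zero_iff (two_ne_zero) |>.mp this
  omega

def Vd (k : ℕ) (R : Type) [CommRing R] : MvPolynomial (Fin k) R :=
  ∏ i : Fin k, ∏ j ∈ Ioi i, (X j - X i)

lemma Vd_eq_det (k : ℕ) (R : Type) [CommRing R] :
    Vd k R = (Matrix.vandermonde (X : Fin k → MvPolynomial (Fin k) R)).det :=
  (Matrix.det_vandermonde _).symm

lemma Vd_swap (k : ℕ) (i j : Fin k) (h : i ≠ j) :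
    rename (Equiv.swap i j) (Vd k ℤ) = - Vd k ℤ := by
  rw [Vd_eq_det, AlgHom.map_det]
  have : (rename (R := ℤ) (Equiv.swap i j)).mapMatrix (Matrix.vandermonde X)
      = (Matrix.vandermonde (X : Fin k → MvPolynomial (Fin k) ℤ)).submatrix (Equiv.swap i j) id := by
    ext a b; simp [Matrix.vandermonde]
  rw [this, Matrix.det_permute, Equiv.Perm.sign_swap h]
  simp

lemma coeff_Vd_odd_int (k n : ℕ) (hn : Odd n) (e : Fin k →₀ ℕ) (i j : Fin k) (h : i ≠ j)
    (he : e i = e j) : coeff e (Vd k ℤ ^ n) = 0 := by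
  have h1 : rename (Equiv.swap i j) (Vd k ℤ ^ n) = - Vd k ℤ ^ n := by
    rw [map_pow, Vd_swap k i j h, hn.neg_pow]
  have h2 := coeff_rename_mapDomain (Equiv.swap i j) (Equiv.injective _) (Vd k ℤ ^ n) e
  have h3 : e.mapDomain (Equiv.swap i j) = e := by
    ext a
    rw [← Finsupp.equivMapDomain_eq_mapDomain, Finsupp.equivMapDomain_apply, Equiv.symm_swap]
    rcases eq_or_ne a i with rfl | ha
    · simp [he]
    · rcases eq_or_ne a j with rfl | hb
      · simp [he]
      · rw [Equiv.swap_apply_of_ne_of_ne ha hb]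
  rw [h1, h3, coeff_neg] at h2
  omega

lemma coeff_Vd_odd (k n : ℕ) (hn : Odd n) (e : Fin k →₀ ℕ) (i j : Fin k) (h : i ≠ j)
    (he : e i = e j) : coeff e (Vd k (ZMod 2) ^ n) = 0 := by
  have : Vd k (ZMod 2) = map (Int.castRingHom (ZMod 2)) (Vd k ℤ) := by
    simp [Vd, map_prod]
  rw [this, ← map_pow, coeff_map, coeff_Vd_odd_int k n hn e i j h he, map_zero]

def permExp {k : ℕ} (σ : Equiv.Perm (Fin k)) : Fin k →₀ ℕ :=
  Finsupp.equivFunOnFinite.symm (fun i => (σ i : ℕ))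

lemma Vd_sum (k : ℕ) : Vd k (ZMod 2) = ∑ σ : Equiv.Perm (Fin k), monomial (permExp σ) 1 := by
  rw [Vd_eq_det, ← Matrix.det_transpose, Matrix.det_apply']
  refine sum_congr rfl fun σ _ => ?_
  have hs : ((Equiv.Perm.sign σ : ℤ) : MvPolynomial (Fin k) (ZMod 2)) = 1 := by
    have : CharP (MvPolynomial (Fin k) (ZMod 2)) 2 := inferInstance
    rcases Int.units_eq_one_or (Equiv.Perm.sign σ) with h | h <;> rw [h] <;> simp [CharTwo.neg_eq]
  rw [hs, one_mul, monomial_eq, C_1, one_mul, Finsupp.prod_fintype _ _ (by simp)]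
  rfl

def lowExp (k q : ℕ) (ρ : Equiv.Perm (Fin k)) : Fin k →₀ ℕ :=
  Finsupp.equivFunOnFinite.symm (fun i => 2 ^ q * (k - 1) - (ρ i : ℕ))

lemma coeff_main (k : ℕ) (q : ℕ) : ∀ ρ : Equiv.Perm (Fin k),
    coeff (lowExp k q ρ) (Vd k (ZMod 2) ^ (2 ^ (q + 1) - 1)) = 1 := by
  induction q with
  | zero =>
    intro ρ
    have : (2 ^ (0 + 1) - 1 : ℕ) = 1 := by norm_num
    rw [this, pow_one, Vd_sum, coeff_sum]
    rw [sum_eq_single (ρ.trans Fin.revPerm)]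
    · rw [coeff_monomial, if_pos]
      ext i
      simp [permExp, lowExp, Fin.val_rev]
      omega
    · intro σ _ hσ
      rw [coeff_monomial, if_neg]
      intro h
      apply hσ
      ext i
      have := DFunLike.congr_fun h i
      simp [permExp, lowExp] at this
      simp [Fin.val_rev, this]
      omega
    · simp
  | succ q ih =>
    intro ρ
    have hpow : 2 ^ (q + 1 + 1) - 1 = 1 + (2 ^ (q + 1) - 1) * 2 := by
      have : 1 ≤ 2 ^ (q + 1) := Nat.one_le_two_pow
      rw [pow_succ 2 (q + 1)]; omega
    have hodd : Odd (2 ^ (q + 1) - 1) := by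
      have : 1 ≤ 2 ^ q := Nat.one_le_two_pow
      exact ⟨2 ^ q - 1, by rw [pow_succ]; omega⟩
    rw [hpow, pow_add, pow_one, pow_mul, ← expand_zmod]
    set W := Vd k (ZMod 2) ^ (2 ^ (q + 1) - 1) with hW
    have hk : ∀ i : Fin k, (i : ℕ) ≤ k - 1 := fun i => by have := i.2; omega
    have hq : 1 ≤ 2 ^ q := Nat.one_le_two_pow
    have hD : k - 1 ≤ 2 ^ q * (k - 1) := Nat.le_mul_of_pos_left _ hq
    have hD2 : 2 ^ (q + 1) * (k - 1) = 2 * (2 ^ q * (k - 1)) := by ring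
    rw [Vd_sum, sum_mul, coeff_sum, sum_eq_single ρ]
    · rw [coeff_monomial_mul', if_pos, one_mul]
      · have : lowExp k (q + 1) ρ - permExp ρ = 2 • lowExp k q ρ := by
          ext i
          have := hk (ρ i)
          simp only [lowExp, permExp, Finsupp.tsub_apply, Finsupp.equivFunOnFinite_symm_apply_apply,
            Finsupp.smul_apply, smul_eq_mul, hD2]
          omega
        rw [this, coeff_expand_smul _ two_ne_zero]
        exact ih ρ
      · intro i
        have := hk (ρ i)
        simp only [lowExp, permExp, Finsupp.equivFunOnFinite_symm_apply_apply, hD2]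
        omega
    · intro σ _ hσ
      rw [coeff_monomial_mul', one_mul]
      split_ifs with hle
      swap; · rfl
      by_cases hpar : ∀ i, 2 ∣ (lowExp k (q + 1) ρ - permExp σ) i
      swap
      · push Not at hpar
        obtain ⟨i, hi⟩ := hpar
        exact coeff_expand_of_not_dvd _ hi
      choose a ha using hpar
      have : lowExp k (q + 1) ρ - permExp σ = 2 • (Finsupp.equivFunOnFinite.symm a) := by
        ext i; rw [ha i]; simp
      rw [this, coeff_expand_smul _ two_ne_zero]
      have hninj : ¬ Function.Injective a := by
        intro hinj
        apply hσ
        apply perm_avg ρ σ (fun i => 2 ^ q * (k - 1) - a i)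
        · intro i
          have h1 := ha i
          have h2 := hle i
          have := hk (ρ i)
          simp only [lowExp, permExp, Finsupp.tsub_apply, Finsupp.equivFunOnFinite_symm_apply_apply,
            hD2] at h1 h2
          omega
        · intro i j hij
          apply hinj
          have h1 := ha i
          have h2 := ha j
          simp only [lowExp, permExp, Finsupp.tsub_apply, Finsupp.equivFunOnFinite_symm_apply_apply,
            hD2] at h1 h2 hij
          omega
      rw [Function.Injective] at hninj
      push Not at hninj
      obtain ⟨i, j, hij, hne⟩ := hninj
      exact coeff_Vd_odd k _ hodd _ i j hne (by simpa using hij)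
    · simp

end PH

namespace PH

open Finset Matrix

section abstractpart

variable {α G : Type} [Fintype α] [DecidableEq α] [Fintype G]

/-- sum over all paths -/
def pathSum (N : ℕ) (M : Fin N → Matrix α α (ZMod 2)) (v : α → ZMod 2) : ZMod 2 :=
  ∑ p : Fin (N + 1) → α, (∏ l : Fin N, M l (p l.castSucc) (p l.succ)) * v (p (Fin.last N))

def phi (v : α → ZMod 2) (X : Matrix α α (ZMod 2)) : ZMod 2 := ∑ σ, (X *ᵥ v) σ

lemma pathSum_aux (N : ℕ) : ∀ (M : Fin N → Matrix α α (ZMod 2)) (v w : α → ZMod 2),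
    ∑ p : Fin (N + 1) → α, w (p 0) * ((∏ l : Fin N, M l (p l.castSucc) (p l.succ)) *
      v (p (Fin.last N))) = ∑ σ, w σ * ((List.ofFn M).prod *ᵥ v) σ := by
  induction N with
  | zero =>
    intro M v w
    rw [← (Equiv.funUnique (Fin 1) α).symm.sum_comp]
    simp
  | succ N ih =>
    intro M v w
    rw [← (Fin.consEquiv (fun _ : Fin (N + 2) => α)).sum_comp, Fintype.sum_prod_type, sum_comm]
    simp only [Fin.consEquiv_apply, Fin.cons_zero, Fin.prod_univ_succ, Fin.castSucc_zero,
      Fin.cons_succ, ← Fin.succ_last, ← Fin.succ_castSucc]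
    have := ih (fun l => M l.succ) v (fun τ => ∑ σ, w σ * M 0 σ τ)
    simp only [sum_mul] at this
    simp only [List.ofFn_succ, List.prod_cons, ← Matrix.mulVec_mulVec]
    calc _ = ∑ p : Fin (N + 1) → α, ∑ σ, w σ * M 0 σ (p 0) *
          ((∏ l : Fin N, M l.succ (p l.castSucc) (p l.succ)) * v (p (Fin.last N))) := by
          refine sum_congr rfl fun p _ => sum_congr rfl fun σ _ => ?_
          ring
      _ = _ := this
      _ = _ := by
          rw [sum_comm]
          refine sum_congr rfl fun σ _ => ?_
          conv_rhs => rw [Matrix.mulVec, dotProduct, mul_sum]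
          refine sum_congr rfl fun τ _ => ?_
          ring

lemma pathSum_eq (N : ℕ) (M : Fin N → Matrix α α (ZMod 2)) (v : α → ZMod 2) :
    pathSum N M v = phi v (List.ofFn M).prod := by
  have := pathSum_aux N M v (fun _ => 1)
  simpa [pathSum, phi] using this

/-- the coboundary of the 0-cochain s as a matrix -/
def cob (K : Matrix α α (ZMod 2)) (s : α → ZMod 2) : Matrix α α (ZMod 2) :=
  fun σ τ => K σ τ * (s σ + s τ)

lemma cob_eq (K : Matrix α α (ZMod 2)) (s : α → ZMod 2) :
    cob K s = K * diagonal s + diagonal s * K := by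
  ext σ τ
  simp [cob]; ring

def Good (act : G → α → α) (K X : Matrix α α (ZMod 2)) : Prop :=
  K * X = X * K ∧ ∀ g σ τ, X (act g σ) (act g τ) = X σ τ

variable (act : G → α → α) (hact : ∀ g, Function.Involutive (act g))

include hact in
lemma inv_mul {X Y : Matrix α α (ZMod 2)} (hX : ∀ g σ τ, X (act g σ) (act g τ) = X σ τ)
    (hY : ∀ g σ τ, Y (act g σ) (act g τ) = Y σ τ) :
    ∀ g σ τ, (X * Y) (act g σ) (act g τ) = (X * Y) σ τ := by
  intro g σ τ
  rw [Matrix.mul_apply, Matrix.mul_apply, ← Equiv.sum_comp (hact g).toPerm]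
  refine sum_congr rfl fun ρ _ => ?_
  simp only [Function.Involutive.coe_toPerm, hX, hY]

include hact in
lemma Good.mul {K X Y : Matrix α α (ZMod 2)} (hX : Good act K X) (hY : Good act K Y) :
    Good act K (X * Y) :=
  ⟨by rw [← mul_assoc, hX.1, mul_assoc, hY.1, mul_assoc], inv_mul act hact hX.2 hY.2⟩

lemma good_cob {K : Matrix α α (ZMod 2)} (hK2 : K * K = 0)
    (hKinv : ∀ g σ τ, K (act g σ) (act g τ) = K σ τ) (s : α → ZMod 2) (κ : G → ZMod 2)
    (hs : ∀ g σ, s (act g σ) = s σ + κ g) : Good act K (cob K s) := by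
  constructor
  · rw [cob_eq, mul_add, add_mul, ← mul_assoc, hK2, mul_assoc _ K K, hK2]
    simp [mul_assoc]
  · intro g σ τ
    simp only [cob, hKinv, hs]
    have : κ g + κ g = 0 := CharTwo.add_self_eq_zero _
    linear_combination (K σ τ) * this

include hact in
lemma phi_cob_zero {K : Matrix α α (ZMod 2)} (hK1 : ∀ τ, ∑ σ, K σ τ = 0)
    (hKinv : ∀ g σ τ, K (act g σ) (act g τ) = K σ τ)
    (ψ T : α → ZMod 2) (hψ : ∀ σ, ∑ g, ψ (act g σ) = 1) (hTinv : ∀ g σ, T (act g σ) = T σ)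
    (hT : ∀ σ, ∑ τ, K σ τ * T τ = 0)
    (Y : Matrix α α (ZMod 2)) (hY : ∀ g σ τ, Y (act g σ) (act g τ) = Y σ τ) :
    phi (fun τ => T τ * ψ τ) (K * Y + Y * K) = 0 := by
  set v : α → ZMod 2 := fun τ => T τ * ψ τ with hv
  have h1 : phi v (K * Y) = 0 := by
    unfold phi
    rw [← Matrix.mulVec_mulVec]
    simp only [Matrix.mulVec, dotProduct]
    rw [sum_comm]
    refine sum_eq_zero fun τ _ => ?_
    rw [← sum_mul, hK1, zero_mul]
  have hz : ∀ σ, ∑ g, (K *ᵥ v) (act g σ) = 0 := by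
    intro σ
    calc ∑ g, (K *ᵥ v) (act g σ) = ∑ g, ∑ τ, K σ τ * T τ * ψ (act g τ) := by
          refine sum_congr rfl fun g _ => ?_
          simp only [Matrix.mulVec, dotProduct]
          rw [← Equiv.sum_comp (hact g).toPerm]
          refine sum_congr rfl fun τ _ => ?_
          simp only [Function.Involutive.coe_toPerm, hKinv, hv, hTinv, mul_assoc]
      _ = ∑ τ, K σ τ * T τ * ∑ g, ψ (act g τ) := by
          rw [sum_comm]
          simp only [mul_sum]
      _ = 0 := by simp only [hψ, mul_one, hT]
  have h2 : phi v (Y * K) = 0 := by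
    unfold phi
    rw [← Matrix.mulVec_mulVec]
    set z := K *ᵥ v with hzdef
    simp only [Matrix.mulVec, dotProduct]
    rw [sum_comm]
    simp only [← sum_mul]
    set y : α → ZMod 2 := fun τ => ∑ σ, Y σ τ with hy
    have hyinv : ∀ g τ, y (act g τ) = y τ := by
      intro g τ
      simp only [hy]
      rw [← Equiv.sum_comp (hact g).toPerm]
      simp only [Function.Involutive.coe_toPerm, hY]
    calc ∑ τ, y τ * z τ = ∑ τ, ∑ g, y τ * z τ * ψ (act g τ) := by
          simp only [← mul_sum, hψ, mul_one]
      _ = ∑ g, ∑ τ, y τ * z (act g τ) * ψ τ := by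
          rw [sum_comm]
          refine sum_congr rfl fun g _ => ?_
          rw [← Equiv.sum_comp (hact g).toPerm]
          refine sum_congr rfl fun τ _ => ?_
          simp only [Function.Involutive.coe_toPerm, hyinv, (hact g) τ]
      _ = ∑ τ, y τ * ψ τ * ∑ g, z (act g τ) := by
          rw [sum_comm]
          refine sum_congr rfl fun τ _ => ?_
          rw [mul_sum]
          refine sum_congr rfl fun g _ => ?_
          ring
      _ = 0 := by simp only [hz, mul_zero, sum_const_zero]
  have : phi v (K * Y + Y * K) = phi v (K * Y) + phi v (Y * K) := by
    simp only [phi, Matrix.add_mulVec, Pi.add_apply, sum_add_distrib]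
  rw [this, h1, h2, add_zero]

lemma phi_add (v : α → ZMod 2) (X Y : Matrix α α (ZMod 2)) :
    phi v (X + Y) = phi v X + phi v Y := by
  simp only [phi, Matrix.add_mulVec, Pi.add_apply, sum_add_distrib]

include hact in
lemma good_prod {K : Matrix α α (ZMod 2)} (N : ℕ) : ∀ (M : Fin N → Matrix α α (ZMod 2)),
    (∀ g σ τ, act g σ = act g τ → σ = τ) →
    (∀ l, Good act K (M l)) → Good act K (List.ofFn M).prod := by
  induction N with
  | zero =>
    intro M hinj _
    simp only [List.ofFn_zero, List.prod_nil]
    refine ⟨by simp, fun g σ τ => ?_⟩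
    by_cases h : σ = τ
    · subst h; simp
    · rw [Matrix.one_apply_ne h, Matrix.one_apply_ne (fun h' => h (hinj g _ _ h'))]
  | succ N ih =>
    intro M hinj hM
    rw [List.ofFn_succ, List.prod_cons]
    exact Good.mul act hact (hM 0) (ih _ hinj fun l => hM l.succ)

include hact in
lemma indep {K : Matrix α α (ZMod 2)} (hK2 : K * K = 0) (hK1 : ∀ τ, ∑ σ, K σ τ = 0)
    (hKinv : ∀ g σ τ, K (act g σ) (act g τ) = K σ τ)
    (ψ T : α → ZMod 2) (hψ : ∀ σ, ∑ g, ψ (act g σ) = 1) (hTinv : ∀ g σ, T (act g σ) = T σ)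
    (hT : ∀ σ, ∑ τ, K σ τ * T τ = 0) (N : ℕ) : ∀ (s s' : Fin N → α → ZMod 2)
    (κ : Fin N → G → ZMod 2) (_ : ∀ l g σ, s l (act g σ) = s l σ + κ l g)
    (_ : ∀ l g σ, s' l (act g σ) = s' l σ + κ l g) (A : Matrix α α (ZMod 2)) (_ : Good act K A),
    phi (fun τ => T τ * ψ τ) (A * (List.ofFn fun l => cob K (s l)).prod)
      = phi (fun τ => T τ * ψ τ) (A * (List.ofFn fun l => cob K (s' l)).prod) := by
  have hinj : ∀ g σ τ, act g σ = act g τ → σ = τ := fun g σ τ h => (hact g).injective h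
  induction N with
  | zero => intro s s' κ _ _ A _; simp
  | succ N ih =>
    intro s s' κ hs hs' A hA
    simp only [List.ofFn_succ, List.prod_cons]
    set B := (List.ofFn fun l : Fin N => cob K (s l.succ)).prod with hB
    have hBg : Good act K B := good_prod act hact N _ hinj
      fun l => good_cob act hK2 hKinv _ (κ l.succ) (hs l.succ)
    set h : α → ZMod 2 := fun σ => s 0 σ + s' 0 σ with hh
    have hsplit : cob K (s 0) = cob K (s' 0) + cob K h := by
      ext σ τ
      simp only [cob, hh, Matrix.add_apply]
      have e1 : s' 0 σ + s' 0 σ = 0 := CharTwo.add_self_eq_zero _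
      have e2 : s' 0 τ + s' 0 τ = 0 := CharTwo.add_self_eq_zero _
      linear_combination (-K σ τ) * e1 - K σ τ * e2
    have hzero : phi (fun τ => T τ * ψ τ) (A * (cob K h * B)) = 0 := by
      have : A * (cob K h * B) = K * (A * diagonal h * B) + (A * diagonal h * B) * K := by
        rw [cob_eq, mul_assoc _ B K, ← hBg.1, mul_assoc A, ← mul_assoc K A, hA.1]
        simp only [add_mul, mul_add, mul_assoc]
      rw [this]
      apply phi_cob_zero act hact hK1 hKinv ψ T hψ hTinv hT
      apply inv_mul act hact _ hBg.2
      apply inv_mul act hact hA.2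
      intro g σ τ
      by_cases h' : σ = τ
      · subst h'
        simp only [diagonal_apply_eq, hh, hs, hs']
        have : κ 0 g + κ 0 g = 0 := CharTwo.add_self_eq_zero _
        linear_combination this
      · rw [Matrix.diagonal_apply_ne _ h', Matrix.diagonal_apply_ne _ (fun h'' => h' (hinj g _ _ h''))]
    rw [hsplit, add_mul, mul_add, phi_add, hzero, add_zero, ← mul_assoc, ← mul_assoc]
    exact ih _ _ (fun l => κ l.succ) (fun l => hs l.succ) (fun l => hs' l.succ) _
      (Good.mul act hact hA (good_cob act hK2 hKinv _ (κ 0) (hs' 0)))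

include hact in
lemma indep' {K : Matrix α α (ZMod 2)} (hK2 : K * K = 0) (hK1 : ∀ τ, ∑ σ, K σ τ = 0)
    (hKinv : ∀ g σ τ, K (act g σ) (act g τ) = K σ τ)
    (ψ T : α → ZMod 2) (hψ : ∀ σ, ∑ g, ψ (act g σ) = 1) (hTinv : ∀ g σ, T (act g σ) = T σ)
    (hT : ∀ σ, ∑ τ, K σ τ * T τ = 0) (N : ℕ) (s s' : Fin N → α → ZMod 2)
    (κ : Fin N → G → ZMod 2) (hs : ∀ l g σ, s l (act g σ) = s l σ + κ l g)
    (hs' : ∀ l g σ, s' l (act g σ) = s' l σ + κ l g) :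
    pathSum N (fun l => cob K (s l)) (fun τ => T τ * ψ τ)
      = pathSum N (fun l => cob K (s' l)) (fun τ => T τ * ψ τ) := by
  have hinj : ∀ g σ τ, act g σ = act g τ → σ = τ := fun g σ τ h => (hact g).injective h
  rw [pathSum_eq, pathSum_eq]
  have := indep act hact hK2 hK1 hKinv ψ T hψ hTinv hT N s s' κ hs hs' 1
    (by simpa using good_prod act hact (K := K) 0 (fun _ => 1) hinj (fun l => l.elim0))
  simpa using this

end abstractpart

end PH

namespace PH

open Finset Matrix

lemma sum_pair_zero {α : Type} [Fintype α] (P : α → Prop) [DecidablePred P]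
    (h : ∀ x, P x → ∃ y, y ≠ x ∧ P y ∧ ∀ z, P z → z = x ∨ z = y) :
    ∑ z, (if P z then (1 : ZMod 2) else 0) = 0 := by
  classical
  by_cases hx : ∃ x, P x
  · obtain ⟨x, hx⟩ := hx
    obtain ⟨y, hyx, hy, hall⟩ := h x hx
    have : (univ.filter P) = {x, y} := by
      ext z
      simp only [mem_filter, mem_univ, true_and, mem_insert, mem_singleton]
      constructor
      · exact hall z
      · rintro (rfl | rfl) <;> assumption
    rw [← sum_filter, this, sum_pair hyx.symm]
    decide
  · push Not at hx
    exact sum_eq_zero fun z _ => if_neg (hx z)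

/-- coordinates -/
abbrev J (k d : ℕ) := Fin k × Fin (d + 1)

def IsCell (k d : ℕ) (L : ℤ) (σ : J k d → ℤ) : Prop :=
  (∀ j, |σ j| ≤ L) ∧ ∀ i, ∃ c, |σ (i, c)| = L

abbrev Cell (k d : ℕ) (L : ℤ) := {σ : J k d → ℤ // IsCell k d L σ}

instance (k d : ℕ) (L : ℤ) : Finite (Cell k d L) := by
  have : ({σ : J k d → ℤ | IsCell k d L σ}).Finite := by
    apply (Set.Finite.pi' (t := fun _ : J k d => Set.Icc (-L) L) fun _ => Set.finite_Icc _ _).subset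
    intro σ h j
    have := h.1 j
    rw [abs_le] at this
    exact this
  exact this

instance (k d : ℕ) (L : ℤ) : Fintype (Cell k d L) := Fintype.ofFinite _

def CovAt {k d : ℕ} (j : J k d) (σ τ : J k d → ℤ) : Prop :=
  Even (σ j) ∧ (τ j = σ j + 1 ∨ τ j = σ j - 1) ∧ ∀ j', j' ≠ j → τ j' = σ j'

def Cov {k d : ℕ} (σ τ : J k d → ℤ) : Prop := ∃ j, CovAt j σ τ

open Classical in
def KK (k d : ℕ) (L : ℤ) : Matrix (Cell k d L) (Cell k d L) (ZMod 2) :=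
  fun σ τ => if Cov σ.1 τ.1 then 1 else 0

def Top {k d : ℕ} (τ : J k d → ℤ) : Prop := ∀ i, ∃ c, ∀ c', Even (τ (i, c')) ↔ c' = c

lemma CovAt.odd {k d : ℕ} {j : J k d} {σ τ : J k d → ℤ} (h : CovAt j σ τ) : ¬ Even (τ j) := by
  obtain ⟨h1, h2, _⟩ := h
  rcases h2 with h2 | h2 <;> rw [h2] <;> grind

variable {k d : ℕ} {L : ℤ} (hL : Even L) (hL0 : 0 < L)

include hL in
lemma KK_sq : KK k d L * KK k d L = 0 := by
  classical
  ext σ τ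
  rw [Matrix.mul_apply, Matrix.zero_apply]
  have : ∀ ρ, KK k d L σ ρ * KK k d L ρ τ = if (Cov σ.1 ρ.1 ∧ Cov ρ.1 τ.1) then 1 else 0 := by
    intro ρ; simp only [KK]; split_ifs <;> simp_all
  simp_rw [this]
  apply sum_pair_zero
  rintro ρ ⟨⟨a, ha⟩, ⟨b, hb⟩⟩
  have hab : a ≠ b := by
    rintro rfl; exact ha.odd hb.1
  have hbo := hb.odd
  have hao : ¬ Even (τ.1 a) := by rw [hb.2.2 a hab]; exact ha.odd
  have hcell : IsCell k d L (fun j => σ.1 j + τ.1 j - ρ.1 j) := by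
    constructor
    · intro j
      by_cases hja : j = a
      · have h : σ.1 j + τ.1 j - ρ.1 j = σ.1 j := by rw [hja, hb.2.2 a hab]; ring
        simp only [h]; exact σ.2.1 j
      · have h : σ.1 j + τ.1 j - ρ.1 j = τ.1 j := by rw [ha.2.2 j hja]; ring
        simp only [h]; exact τ.2.1 j
    · intro i
      obtain ⟨c, hc⟩ := τ.2.2 i
      refine ⟨c, ?_⟩
      have he : Even (τ.1 (i, c)) := by rw [← even_abs, hc]; exact hL
      have hja : (i, c) ≠ a := by rintro rfl; exact hao he
      have h : σ.1 (i, c) + τ.1 (i, c) - ρ.1 (i, c) = τ.1 (i, c) := by rw [ha.2.2 _ hja]; ring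
      simp only [h]; exact hc
  refine ⟨⟨_, hcell⟩, ?_, ⟨⟨b, ?_, ?_, ?_⟩, ⟨a, ?_, ?_, ?_⟩⟩, ?_⟩
  · intro h
    have := congrFun (congrArg Subtype.val h) a
    have h2 := hb.2.2 a hab
    have h3 := ha.2.1
    simp only at this
    omega
  · rw [← ha.2.2 b hab.symm]; exact hb.1
  · have h2 := ha.2.2 b hab.symm
    have h3 := hb.2.1
    simp only; omega
  · intro j' hj'
    have := hb.2.2 j' hj'
    simp only; omega
  · have := hb.2.2 a hab
    simp only [this]; simpa using ha.1
  · have h2 := hb.2.2 a hab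
    have h3 := ha.2.1
    simp only; omega
  · intro j' hj'
    have := ha.2.2 j' hj'
    simp only; omega
  · rintro ρ' ⟨⟨a', ha'⟩, ⟨b', hb'⟩⟩
    have hab' : a' ≠ b' := by
      rintro rfl; exact ha'.odd hb'.1
    have hmem : a' = a ∨ a' = b := by
      by_contra hcon
      push Not at hcon
      have h1 := hb.2.2 a' hcon.2
      have h2 := ha.2.2 a' hcon.1
      have h3 := hb'.2.2 a' hab'
      have h4 := ha'.2.1
      omega
    rcases hmem with h | h
    · left
      ext j
      by_cases hj : j = a
      · subst hj; rw [← hb.2.2 j hab, ← hb'.2.2 j (h ▸ hab')]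
      · rw [ha.2.2 j hj, ha'.2.2 j (h ▸ hj)]
    · right
      ext j
      simp only
      by_cases hj : j = b
      · have h1 := ha.2.2 j (hj ▸ hab.symm)
        have h2 := hb'.2.2 j (by rw [hj, ← h]; exact hab')
        omega
      · have h1 := hb.2.2 j hj
        have h2 := ha'.2.2 j (by rw [h]; exact hj)
        omega

include hL in
lemma KK_col (τ : Cell k d L) : ∑ σ, KK k d L σ τ = 0 := by
  classical
  simp only [KK]
  rw [← sum_filter]
  have hcell : ∀ σ : Cell k d L, Cov σ.1 τ.1 → IsCell k d L (fun j => 2 * τ.1 j - σ.1 j) := by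
    rintro σ ⟨a, ha⟩
    constructor
    · intro j
      by_cases hj : j = a
      · subst hj
        have h1 := τ.2.1 j
        have h2 := ha.2.1
        have h3 := ha.odd
        have h4 := σ.2.1 j
        have h5 : |τ.1 j| ≠ L := by
          intro h; apply h3; rw [← even_abs, h]; exact hL
        rw [abs_le] at h4 ⊢
        have h6 : |τ.1 j| < L := lt_of_le_of_ne h1 h5
        rw [abs_lt] at h6
        dsimp only
        constructor <;> omega
      · have := ha.2.2 j hj
        have h : 2 * τ.1 j - σ.1 j = τ.1 j := by omega
        simp only [h]; exact τ.2.1 j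
    · intro i
      obtain ⟨c, hc⟩ := τ.2.2 i
      refine ⟨c, ?_⟩
      have he : Even (τ.1 (i, c)) := by rw [← even_abs, hc]; exact hL
      have hja : (i, c) ≠ a := by rintro rfl; exact ha.odd he
      have h : 2 * τ.1 (i, c) - σ.1 (i, c) = τ.1 (i, c) := by rw [ha.2.2 _ hja]; ring
      simp only [h]; exact hc
  refine sum_involution (fun σ hσ => ⟨_, hcell σ (mem_filter.mp hσ).2⟩) ?_ ?_ ?_ ?_
  · intro σ hσ; decide
  · intro σ hσ _ h
    obtain ⟨a, ha⟩ := (mem_filter.mp hσ).2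
    have := congrFun (congrArg Subtype.val h) a
    have h3 := ha.2.1
    simp only at this
    omega
  · intro σ hσ
    obtain ⟨a, ha⟩ := (mem_filter.mp hσ).2
    simp only [mem_filter, mem_univ, true_and]
    refine ⟨a, ?_, ?_, ?_⟩
    · have := ha.odd
      have := ha.1
      simp only [Int.even_sub]
      simp [this]
    · have h3 := ha.2.1
      simp only; omega
    · intro j hj
      have := ha.2.2 j hj
      simp only; omega
  · intro σ hσ
    ext j
    simp only; ring

include hL hL0 in
lemma KK_top (σ : Cell k d L) :
    ∑ τ, KK k d L σ τ * (open Classical in if Top τ.1 then 1 else 0) = 0 := by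
  classical
  have : ∀ τ, KK k d L σ τ * (if Top τ.1 then 1 else 0) =
      if (Cov σ.1 τ.1 ∧ Top τ.1) then 1 else 0 := by
    intro ρ; simp only [KK]; split_ifs <;> simp_all
  simp_rw [this]
  apply sum_pair_zero
  rintro τ ⟨⟨a, ha⟩, htop⟩
  obtain ⟨i, c0⟩ := a
  obtain ⟨e, he⟩ := htop i
  have heL : |τ.1 (i, e)| = L := by
    obtain ⟨c, hc⟩ := τ.2.2 i
    have : Even (τ.1 (i, c)) := by rw [← even_abs, hc]; exact hL
    rw [← (he c).mp this]; exact hc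
  have hc0e : c0 ≠ e := fun h => ha.odd ((he c0).mpr h)
  have hne : (i, e) ≠ (i, c0) := by simp [hc0e.symm]
  have hσe : σ.1 (i, e) = τ.1 (i, e) := (ha.2.2 _ hne).symm
  have hσL : |σ.1 (i, e)| = L := by rw [hσe]; exact heL
  have hσev : Even (σ.1 (i, e)) := by rw [hσe]; exact (he e).mpr rfl
  -- other covers
  have hmem : ∀ (z : Cell k d L) (b : J k d), CovAt b σ.1 z.1 → Top z.1 →
      b = (i, c0) ∨ b = (i, e) := by
    rintro z ⟨i', c'⟩ hz hzt
    by_contra hcon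
    push Not at hcon
    obtain ⟨e', he'⟩ := hzt i
    have h1 : e = e' := (he' e).mp (by rw [hz.2.2 _ hcon.2.symm]; exact hσev)
    have h2 : c0 = e' := (he' c0).mp (by rw [hz.2.2 _ hcon.1.symm]; exact ha.1)
    exact hc0e (h2.trans h1.symm)
  have hσc := σ.2.1 (i, c0)
  rcases lt_or_eq_of_le hσc with hlt | heq
  · have hcell : IsCell k d L (Function.update σ.1 (i, c0) (2 * σ.1 (i, c0) - τ.1 (i, c0))) := by
      constructor
      · intro j
        by_cases hj : j = (i, c0)
        · subst hj
          have h2 := ha.2.1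
          rw [abs_lt] at hlt
          rw [Function.update_self, abs_le]
          constructor <;> omega
        · rw [Function.update_of_ne hj]; exact σ.2.1 j
      · intro i'
        by_cases hi : i' = i
        · subst hi
          exact ⟨e, by rw [Function.update_of_ne hne]; exact hσL⟩
        · obtain ⟨c, hc⟩ := σ.2.2 i'
          exact ⟨c, by rw [Function.update_of_ne (by simp [hi])]; exact hc⟩
    refine ⟨⟨_, hcell⟩, ?_, ⟨⟨(i, c0), ha.1, ?_, ?_⟩, ?_⟩, ?_⟩
    · intro h
      have := congrFun (congrArg Subtype.val h) (i, c0)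
      have h2 := ha.2.1
      simp only [Function.update_self] at this
      omega
    · have h2 := ha.2.1
      simp only [Function.update_self]
      omega
    · intro j hj
      simp only [Function.update_of_ne hj]
    · intro i'
      by_cases hi : i' = i
      · subst hi
        refine ⟨e, fun c' => ?_⟩
        by_cases hc : c' = c0
        · subst hc
          have h1 := he c'
          have h2 := ha.odd
          simp only [Function.update_self, Int.even_sub]
          simp [h2, hc0e]
        · dsimp only
          rw [Function.update_of_ne (by simp [hc]), ← ha.2.2 (i', c') (by simp [hc])]
          exact he c'
      · obtain ⟨c, hc⟩ := htop i'
        refine ⟨c, fun c' => ?_⟩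
        dsimp only
        rw [Function.update_of_ne (by simp [hi]), ← ha.2.2 (i', c') (by simp [hi])]
        exact hc c'
    · rintro z ⟨⟨b, hb⟩, hzt⟩
      rcases hmem z b hb hzt with rfl | rfl
      · have h1 := ha.2.1
        have h2 := hb.2.1
        by_cases hz : z.1 (i, c0) = τ.1 (i, c0)
        · left; ext j
          by_cases hj : j = (i, c0)
          · rw [hj, hz]
          · rw [hb.2.2 j hj, ha.2.2 j hj]
        · right; ext j
          by_cases hj : j = (i, c0)
          · subst hj; simp only [Function.update_self]; omega
          · rw [hb.2.2 j hj]; simp only [Function.update_of_ne hj]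
      · exfalso
        obtain ⟨e', he'⟩ := hzt i
        obtain ⟨c, hc⟩ := z.2.2 i
        have h1 : Even (z.1 (i, c)) := by rw [← even_abs, hc]; exact hL
        have h2 : Even (z.1 (i, c0)) := by rw [hb.2.2 _ hne.symm]; exact ha.1
        rw [(he' c).mp h1, ← (he' c0).mp h2, hb.2.2 _ hne.symm] at hc
        omega
  · obtain ⟨u, hu1, hu2, hu3⟩ : ∃ u : ℤ, (u = 1 ∨ u = -1) ∧ |σ.1 (i, e) + u| ≤ L ∧
        ∀ w : ℤ, (w = 1 ∨ w = -1) → |σ.1 (i, e) + w| ≤ L → w = u := by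
      rcases le_or_gt 0 (σ.1 (i, e)) with h | h
      · rw [abs_of_nonneg h] at hσL
        refine ⟨-1, by simp, ?_, ?_⟩
        · rw [abs_le]; omega
        · intro w hw; rw [abs_le]; omega
      · rw [abs_of_neg h] at hσL
        refine ⟨1, by simp, ?_, ?_⟩
        · rw [abs_le]; omega
        · intro w hw; rw [abs_le]; omega
    have huo : ¬ Even (σ.1 (i, e) + u) := by
      rcases hu1 with rfl | rfl <;> grind
    have hcell : IsCell k d L (Function.update σ.1 (i, e) (σ.1 (i, e) + u)) := by
      constructor
      · intro j
        by_cases hj : j = (i, e)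
        · subst hj
          rw [Function.update_self]; exact hu2
        · rw [Function.update_of_ne hj]; exact σ.2.1 j
      · intro i'
        by_cases hi : i' = i
        · subst hi
          exact ⟨c0, by rw [Function.update_of_ne hne.symm]; exact heq⟩
        · obtain ⟨c, hc⟩ := σ.2.2 i'
          exact ⟨c, by rw [Function.update_of_ne (by simp [hi])]; exact hc⟩
    refine ⟨⟨_, hcell⟩, ?_, ⟨⟨(i, e), hσev, ?_, ?_⟩, ?_⟩, ?_⟩
    · intro h
      have := congrFun (congrArg Subtype.val h) (i, e)
      simp only [Function.update_self] at this
      omega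
    · simp only [Function.update_self]
      omega
    · intro j hj
      simp only [Function.update_of_ne hj]
    · intro i'
      by_cases hi : i' = i
      · subst hi
        refine ⟨c0, fun c' => ?_⟩
        by_cases hc : c' = e
        · subst hc
          simp only [Function.update_self]
          simp [huo, hc0e.symm]
        · dsimp only
          rw [Function.update_of_ne (by simp [hc])]
          by_cases hc' : c' = c0
          · subst hc'; simpa using ha.1
          · rw [← ha.2.2 (i', c') (by simp [hc'])]
            simp [he c', hc, hc']
      · obtain ⟨c, hc⟩ := htop i'
        refine ⟨c, fun c' => ?_⟩
        dsimp only
        rw [Function.update_of_ne (by simp [hi]), ← ha.2.2 (i', c') (by simp [hi])]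
        exact hc c'
    · rintro z ⟨⟨b, hb⟩, hzt⟩
      rcases hmem z b hb hzt with rfl | rfl
      · left; ext j
        by_cases hj : j = (i, c0)
        · subst hj
          have h1 := ha.2.1
          have h2 := hb.2.1
          have h3 := z.2.1 (i, c0)
          have h4 := τ.2.1 (i, c0)
          rw [abs_le] at h3 h4
          rcases abs_eq hL0.le |>.mp heq with h | h <;> omega
        · rw [hb.2.2 j hj, ha.2.2 j hj]
      · right; ext j
        by_cases hj : j = (i, e)
        · subst hj; simp only [Function.update_self]
          have h2 := hb.2.1
          have h3 := z.2.1 (i, e)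
          have := hu3 (z.1 (i, e) - σ.1 (i, e)) (by omega) (by simpa using h3)
          omega
        · rw [hb.2.2 j hj]; simp only [Function.update_of_ne hj]

end PH

namespace PH

open Finset Matrix

def sgn (a : ZMod 2) : ℤ := if a = 0 then 1 else -1

lemma zmod2_cases (a : ZMod 2) : a = 0 ∨ a = 1 := by
  revert a; decide

lemma sgn_sq (a : ZMod 2) : sgn a * sgn a = 1 := by revert a; decide

lemma abs_sgn (a : ZMod 2) : |sgn a| = 1 := by revert a; decide

/-- sign of x, with default e -/
def cs {R : Type} [LinearOrder R] [Zero R] (x : R) (e : ZMod 2) : ZMod 2 :=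
  if 0 < x then 0 else if x < 0 then 1 else e

lemma cs_sgn {R : Type} [Ring R] [LinearOrder R] [IsStrictOrderedRing R] (x : R) (e a : ZMod 2) :
    cs ((sgn a : R) * x) (e + a) = cs x e + a := by
  rcases zmod2_cases a with rfl | rfl
  · simp [sgn]
  · have : sgn 1 = -1 := by decide
    rw [this]
    simp only [cs]
    rcases lt_trichotomy x 0 with h | h | h
    · simp [h, h.not_gt]; decide
    · simp [h]
    · simp [h, h.not_gt]

lemma cs_sgn_int (x : ℤ) (e a : ZMod 2) : cs (sgn a * x) (e + a) = cs x e + a := by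
  simpa using cs_sgn x e a

open Classical in
def eps {d : ℕ} (v : Fin (d + 1) → ℤ) : ZMod 2 :=
  cs (v (Fin.last d)) (if WellOrderingRel v (-v) then 0 else 1)

lemma eps_sgn {d : ℕ} (v : Fin (d + 1) → ℤ) (hv : v ≠ 0) (a : ZMod 2) :
    eps (fun c => sgn a * v c) = eps v + a := by
  classical
  unfold eps
  rw [← cs_sgn_int]
  congr 1
  rcases zmod2_cases a with rfl | rfl
  · simp [sgn]
  · have h1 : sgn 1 = -1 := by decide
    have h2 : (fun c => sgn 1 * v c) = -v := by ext c; simp [h1]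
    rw [h2, neg_neg]
    have hne : v ≠ -v := by
      intro h; apply hv; ext c
      have := congrFun h c
      simp only [Pi.neg_apply, Pi.zero_apply] at this ⊢
      omega
    by_cases h : WellOrderingRel v (-v)
    · have h' : ¬ WellOrderingRel (-v) v := fun h'' => asymm_of WellOrderingRel h h''
      simp [h, h']
    · have h' : WellOrderingRel (-v) v := by
        rcases trichotomous_of WellOrderingRel v (-v) with h'' | h'' | h''
        · exact absurd h'' h
        · exact absurd h'' hne
        · exact h''
      simp [h, h']; decide

variable {k d : ℕ} {L : ℤ}

lemma isCell_act (g : Fin k → ZMod 2) (σ : J k d → ℤ) (h : IsCell k d L σ) :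
    IsCell k d L (fun j => sgn (g j.1) * σ j) := by
  constructor
  · intro j; simp only [abs_mul, abs_sgn, one_mul]; exact h.1 j
  · intro i; obtain ⟨c, hc⟩ := h.2 i
    exact ⟨c, by simp only [abs_mul, abs_sgn, one_mul]; exact hc⟩

def act (g : Fin k → ZMod 2) (σ : Cell k d L) : Cell k d L := ⟨_, isCell_act g σ.1 σ.2⟩

lemma act_apply (g : Fin k → ZMod 2) (σ : Cell k d L) (j : J k d) :
    (act g σ).1 j = sgn (g j.1) * σ.1 j := rfl

lemma act_invol (g : Fin k → ZMod 2) : Function.Involutive (act g : Cell k d L → Cell k d L) := by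
  intro σ
  ext j
  rw [act_apply, act_apply, ← mul_assoc, sgn_sq, one_mul]

lemma even_sgn (a : ZMod 2) (x : ℤ) : Even (sgn a * x) ↔ Even x := by
  rcases zmod2_cases a with rfl | rfl <;> simp [sgn]

lemma cov_act (g : Fin k → ZMod 2) (σ τ : Cell k d L) (h : Cov σ.1 τ.1) :
    Cov (act g σ).1 (act g τ).1 := by
  obtain ⟨j, h1, h2, h3⟩ := h
  refine ⟨j, ?_, ?_, ?_⟩
  · rw [act_apply, even_sgn]; exact h1
  · rw [act_apply, act_apply]
    rcases zmod2_cases (g j.1) with h | h <;> rw [h] <;> simp only [sgn] <;> simp <;> omega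
  · intro j' hj'
    rw [act_apply, act_apply, h3 j' hj']

lemma KK_act (g : Fin k → ZMod 2) (σ τ : Cell k d L) :
    KK k d L (act g σ) (act g τ) = KK k d L σ τ := by
  classical
  have : Cov (act g σ).1 (act g τ).1 ↔ Cov σ.1 τ.1 := by
    constructor
    · intro h
      have := cov_act g _ _ h
      rwa [act_invol, act_invol] at this
    · exact cov_act g σ τ
  simp only [KK, this]

open Classical in
def TT (τ : Cell k d L) : ZMod 2 := if Top τ.1 then 1 else 0

lemma TT_act (g : Fin k → ZMod 2) (σ : Cell k d L) : TT (act g σ) = TT σ := by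
  classical
  have : Top (act g σ).1 ↔ Top σ.1 := by simp only [Top, act_apply, even_sgn]
  simp only [TT, this]

def psi (σ : Cell k d L) : ZMod 2 := ∏ i, (1 + eps (fun c => σ.1 (i, c)))

lemma block_ne (hL0 : 0 < L) (σ : Cell k d L) (i : Fin k) : (fun c => σ.1 (i, c)) ≠ 0 := by
  intro h
  obtain ⟨c, hc⟩ := σ.2.2 i
  have := congrFun h c
  simp only [Pi.zero_apply] at this
  rw [this] at hc
  simp at hc; omega

lemma eps_act (hL0 : 0 < L) (g : Fin k → ZMod 2) (σ : Cell k d L) (i : Fin k) :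
    eps (fun c => (act g σ).1 (i, c)) = eps (fun c => σ.1 (i, c)) + g i := by
  rw [← eps_sgn _ (block_ne hL0 σ i)]; rfl

lemma psi_sum (hL0 : 0 < L) (σ : Cell k d L) : ∑ g : Fin k → ZMod 2, psi (act g σ) = 1 := by
  simp only [psi, eps_act hL0]
  have := (Finset.prod_univ_sum (fun _ : Fin k => (univ : Finset (ZMod 2)))
    (fun i a => (1 + (eps (fun c => σ.1 (i, c)) + a)))).symm
  rw [Fintype.piFinset_univ] at this
  rw [this]
  have h : ∀ e : ZMod 2, ∑ a : ZMod 2, (1 + (e + a)) = 1 := by decide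
  simp [h]

def tau (j : J k d) (σ : Cell k d L) : ZMod 2 := cs (σ.1 j) (eps (fun c => σ.1 (j.1, c)))

lemma tau_act (hL0 : 0 < L) (j : J k d) (g : Fin k → ZMod 2) (σ : Cell k d L) :
    tau j (act g σ) = tau j σ + g j.1 := by
  unfold tau
  rw [eps_act hL0, act_apply, cs_sgn_int]

/-- nonzero paths -/
lemma path_cov {N : ℕ} {s : Fin N → Cell k d L → ZMod 2} {p : Fin (N + 1) → Cell k d L}
    (h : (∏ l : Fin N, cob (KK k d L) (s l) (p l.castSucc) (p l.succ)) *
      (TT (p (Fin.last N)) * psi (p (Fin.last N))) ≠ 0) :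
    (∀ l : Fin N, Cov (p l.castSucc).1 (p l.succ).1) ∧
    (∀ l : Fin N, s l (p l.castSucc) ≠ s l (p l.succ)) ∧ Top (p (Fin.last N)).1 ∧
    ∀ i, eps (fun c => (p (Fin.last N)).1 (i, c)) = 0 := by
  classical
  have h1 := left_ne_zero_of_mul h
  have h2 := right_ne_zero_of_mul h
  rw [prod_ne_zero_iff] at h1
  refine ⟨fun l => ?_, fun l => ?_, ?_, fun i => ?_⟩
  · have := left_ne_zero_of_mul (h1 l (mem_univ l))
    by_contra hc
    simp [KK, hc] at this
  · have := right_ne_zero_of_mul (h1 l (mem_univ l))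
    intro hc
    rw [hc, CharTwo.add_self_eq_zero] at this
    exact this rfl
  · have := left_ne_zero_of_mul h2
    by_contra hc
    simp [TT, hc] at this
  · have := right_ne_zero_of_mul h2
    rw [psi, prod_ne_zero_iff] at this
    have := this i (mem_univ i)
    revert this
    generalize eps (fun c => (p (Fin.last N)).1 (i, c)) = e
    revert e; decide

lemma path_le {N : ℕ} {p : Fin (N + 1) → Cell k d L}
    (h : ∀ l : Fin N, Cov (p l.castSucc).1 (p l.succ).1) (l : Fin (N + 1)) (j : J k d) :
    (p l).1 j = (p (Fin.last N)).1 j ∨ (Even ((p l).1 j) ∧ ¬ Even ((p (Fin.last N)).1 j) ∧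
      |(p l).1 j - (p (Fin.last N)).1 j| ≤ 1) := by
  induction l using Fin.reverseInduction with
  | last => left; rfl
  | cast l ih =>
    obtain ⟨a, ha⟩ := h l
    by_cases hj : j = a
    · subst hj
      right
      have hodd := ha.odd
      rcases ih with ih | ih
      · rw [← ih]
        refine ⟨ha.1, hodd, ?_⟩
        have := ha.2.1
        rw [abs_le]; omega
      · exact absurd ih.1 hodd
    · rw [← ha.2.2 j hj]; exact ih

lemma tau_const {N : ℕ} {p : Fin (N + 1) → Cell k d L} (hL : Even L) (hL0 : 0 < L)
    (h : ∀ l : Fin N, Cov (p l.castSucc).1 (p l.succ).1) (i : Fin k) (c : Fin (d + 1))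
    (hc : |(p (Fin.last N)).1 (i, c)| = L) (l l' : Fin (N + 1)) :
    tau (i, c) (p l) = tau (i, c) (p l') := by
  have he : Even ((p (Fin.last N)).1 (i, c)) := by rw [← even_abs, hc]; exact hL
  have key : ∀ l, (p l).1 (i, c) = (p (Fin.last N)).1 (i, c) := by
    intro l
    rcases path_le h l (i, c) with h | h
    · exact h
    · exact absurd he h.2.1
  have hne : (p (Fin.last N)).1 (i, c) ≠ 0 := by
    intro h; rw [h] at hc; simp at hc; omega
  unfold tau
  rw [key l, key l']
  unfold cs
  split_ifs <;> first | rfl | omega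

lemma eval_zero (hL : Even L) (hL0 : 0 < L) {N : ℕ} (w : Fin N → J k d)
    (i : Fin k) (hw : ∀ c, ∃ l, w l = (i, c)) :
    pathSum N (fun l => cob (KK k d L) (tau (w l))) (fun τ => TT τ * psi τ) = 0 := by
  unfold pathSum
  refine sum_eq_zero fun p _ => ?_
  by_contra hne
  obtain ⟨h1, h2, _, _⟩ := path_cov hne
  obtain ⟨c, hc⟩ := (p (Fin.last N)).2.2 i
  obtain ⟨l, hl⟩ := hw c
  apply h2 l
  rw [hl]
  exact tau_const hL hL0 h1 i c hc _ _

lemma eval_one (hL : Even L) (hL0 : 0 < L) {N : ℕ} (w : Fin N → J k d)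
    (hinj : Function.Injective w) (hlast : ∀ l, (w l).2 ≠ Fin.last d)
    (hsurj : ∀ j : J k d, j.2 ≠ Fin.last d → ∃ l, w l = j) :
    pathSum N (fun l => cob (KK k d L) (tau (w l))) (fun τ => TT τ * psi τ) = 1 := by
  classical
  let P0 : ℕ → J k d → ℤ := fun n j => if j.2 = Fin.last d then L else
    if ∃ l, w l = j ∧ l.val < n then -1 else 0
  have hcell : ∀ n, IsCell k d L (P0 n) := by
    intro n
    constructor
    · intro j
      simp only [P0]
      split_ifs
      · exact (abs_of_pos hL0).le
      · simp; omega
      · simp; omega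
    · intro i
      exact ⟨Fin.last d, by simp [P0, abs_of_pos hL0]⟩
  let P : Fin (N + 1) → Cell k d L := fun n => ⟨P0 n.val, hcell n.val⟩
  have hPlast : ∀ n i, (P n).1 (i, Fin.last d) = L := by
    intro n i; simp [P, P0]
  have hPw : ∀ n l, (P n).1 (w l) = if l.val < n.val then -1 else 0 := by
    intro n l
    simp only [P, P0, hlast l, if_false]
    congr 1
    apply propext
    constructor
    · rintro ⟨l', h1, h2⟩; rw [← hinj h1]; exact h2
    · intro h; exact ⟨l, rfl, h⟩
  have htau : ∀ (σ : Cell k d L) (j : J k d), (∀ i, σ.1 (i, Fin.last d) = L) →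
      tau j σ = if σ.1 j < 0 then 1 else 0 := by
    intro σ j h
    have : eps (fun c => σ.1 (j.1, c)) = 0 := by
      simp only [eps, cs, h, hL0, if_true]
    unfold tau
    rw [this]
    unfold cs
    split_ifs <;> first | rfl | omega
  unfold pathSum
  rw [sum_eq_single P]
  · have hK : ∀ l : Fin N, cob (KK k d L) (tau (w l)) (P l.castSucc) (P l.succ) = 1 := by
      intro l
      have hcov : Cov (P l.castSucc).1 (P l.succ).1 := by
        refine ⟨w l, ?_, ?_, ?_⟩
        · rw [hPw]; simp
        · rw [hPw, hPw]; simp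
        · intro j hj
          by_cases hjl : j.2 = Fin.last d
          · obtain ⟨i, c⟩ := j
            simp only at hjl
            subst hjl
            rw [hPlast, hPlast]
          · obtain ⟨l', rfl⟩ := hsurj j hjl
            have : l' ≠ l := fun h => hj (by rw [h])
            rw [hPw, hPw]
            have h' : l'.val ≠ l.val := fun h => this (Fin.ext h)
            simp only [Fin.val_succ, Fin.val_castSucc]
            split_ifs <;> first | rfl | omega
      simp only [cob, KK, hcov, if_true, one_mul]
      rw [htau _ _ (hPlast _), htau _ _ (hPlast _), hPw, hPw]
      simp
    have hT : TT (P (Fin.last N)) = 1 := by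
      have : Top (P (Fin.last N)).1 := by
        intro i
        refine ⟨Fin.last d, fun c' => ?_⟩
        constructor
        · intro h
          by_contra hc
          obtain ⟨l, hl⟩ := hsurj (i, c') hc
          rw [← hl, hPw] at h
          simp at h
        · rintro rfl; rw [hPlast]; exact hL
      simp [TT, this]
    have hψ : psi (P (Fin.last N)) = 1 := by
      unfold psi
      apply prod_eq_one
      intro i _
      simp only [eps, cs, hPlast, hL0, if_true, add_zero]
    simp only [hK, hT, hψ]
    simp
  · intro p _ hp
    by_contra hne
    apply hp
    obtain ⟨h1, h2, h3, h4⟩ := path_cov hne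
    have hlastL : ∀ i, (p (Fin.last N)).1 (i, Fin.last d) = L := by
      intro i
      obtain ⟨c, hc⟩ := (p (Fin.last N)).2.2 i
      have hcl : c = Fin.last d := by
        by_contra hcl
        obtain ⟨l, hl⟩ := hsurj (i, c) hcl
        apply h2 l
        rw [hl]
        exact tau_const hL hL0 h1 i c hc _ _
      subst hcl
      rcases (abs_eq hL0.le).mp hc with h | h
      · exact h
      · exfalso
        have := h4 i
        simp only [eps, cs, h] at this
        rw [if_neg (by omega), if_pos (by omega)] at this
        exact absurd this (by decide)
    have hallL : ∀ l i, (p l).1 (i, Fin.last d) = L := by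
      intro l i
      rcases path_le h1 l (i, Fin.last d) with h | h
      · rw [h, hlastL]
      · exact absurd (by rw [hlastL]; exact hL) h.2.1
    have hstep : ∀ l : Fin N, (p l.castSucc).1 (w l) = 0 ∧ (p l.succ).1 (w l) = -1 ∧
        ∀ j, j ≠ w l → (p l.succ).1 j = (p l.castSucc).1 j := by
      intro l
      obtain ⟨a, ha⟩ := h1 l
      have h := h2 l
      rw [htau _ _ (hallL _), htau _ _ (hallL _)] at h
      have haw : a = w l := by
        by_contra hc
        rw [ha.2.2 _ (Ne.symm hc)] at h
        exact h rfl
      subst haw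
      obtain ⟨⟨r, hr⟩, hb, hcc⟩ := ha
      have : (p l.castSucc).1 (w l) = 0 ∧ (p l.succ).1 (w l) = -1 := by
        split_ifs at h <;> first | omega | simp at h
      exact ⟨this.1, this.2, hcc⟩
    have hval : ∀ l' : Fin N, ∀ l : Fin (N + 1), (p l).1 (w l') =
        if l'.val < l.val then -1 else (p 0).1 (w l') := by
      intro l' l
      induction l using Fin.induction with
      | zero => simp
      | succ l ih =>
        by_cases hll : l' = l
        · subst hll
          rw [(hstep l').2.1]; simp
        · rw [(hstep l).2.2 _ (fun h => hll (hinj h)), ih]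
          have h' : l'.val ≠ l.val := fun h => hll (Fin.ext h)
          simp only [Fin.val_succ, Fin.val_castSucc]
          split_ifs <;> first | rfl | omega
    have hval0 : ∀ l' : Fin N, (p 0).1 (w l') = 0 := by
      intro l'
      have := hval l' l'.castSucc
      rw [(hstep l').1] at this
      simpa using this.symm
    ext n j
    by_cases hj : j.2 = Fin.last d
    · obtain ⟨i, c⟩ := j
      simp only at hj
      subst hj
      rw [hallL, hPlast]
    · obtain ⟨l, rfl⟩ := hsurj j hj
      rw [hval, hval0, hPw]
  · simp

end PH

namespace PH

open Finset Matrix MvPolynomial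

variable {k d : ℕ} {L : ℤ}

lemma indepC (hL : Even L) (hL0 : 0 < L) (N : ℕ) (s s' : Fin N → Cell k d L → ZMod 2)
    (κ : Fin N → (Fin k → ZMod 2) → ZMod 2) (hs : ∀ l g σ, s l (act g σ) = s l σ + κ l g)
    (hs' : ∀ l g σ, s' l (act g σ) = s' l σ + κ l g) :
    pathSum N (fun l => cob (KK k d L) (s l)) (fun τ => TT τ * psi τ)
      = pathSum N (fun l => cob (KK k d L) (s' l)) (fun τ => TT τ * psi τ) := by
  classical
  exact indep' act act_invol (KK_sq hL) (KK_col hL) KK_act psi TT (psi_sum hL0) TT_act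
    (fun σ => KK_top hL hL0 σ) N s s' κ hs hs'

lemma cob_sum {α ι : Type} [Fintype ι] (K : Matrix α α (ZMod 2)) (a : ι → ZMod 2)
    (s : ι → α → ZMod 2) (σ τ : α) :
    cob K (fun σ => ∑ i, a i * s i σ) σ τ = ∑ i, a i * cob K (s i) σ τ := by
  simp only [cob, ← sum_add_distrib, mul_sum]
  refine sum_congr rfl fun i _ => ?_
  ring

lemma pathSum_expand {α ι : Type} [Fintype α] [Fintype ι] [DecidableEq ι] (N : ℕ)
    (K : Matrix α α (ZMod 2)) (a : Fin N → ι → ZMod 2) (s : ι → α → ZMod 2) (v : α → ZMod 2) :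
    pathSum N (fun l => cob K (fun σ => ∑ i, a l i * s i σ)) v =
      ∑ w : Fin N → ι, (∏ l, a l (w l)) * pathSum N (fun l => cob K (s (w l))) v := by
  unfold pathSum
  simp only [cob_sum, mul_sum]
  rw [sum_comm]
  refine sum_congr rfl fun p _ => ?_
  rw [Finset.prod_univ_sum, Fintype.piFinset_univ, sum_mul]
  refine sum_congr rfl fun w _ => ?_
  rw [prod_mul_distrib, mul_assoc]

lemma coeff_expand {N : ℕ} (χ : Fin N → Fin k → ZMod 2) (e : Fin k →₀ ℕ) :
    coeff e (∏ l, ∑ i, C (χ l i) * X i : MvPolynomial (Fin k) (ZMod 2)) =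
      ∑ w : Fin N → Fin k, (∏ l, χ l (w l)) *
        (if (∑ l, Finsupp.single (w l) 1 : Fin k →₀ ℕ) = e then 1 else 0) := by
  rw [Finset.prod_univ_sum, Fintype.piFinset_univ, coeff_sum]
  refine sum_congr rfl fun w _ => ?_
  rw [prod_mul_distrib, ← map_prod, coeff_C_mul]
  congr 1
  have : (∏ l, X (w l) : MvPolynomial (Fin k) (ZMod 2)) =
      monomial (∑ l, Finsupp.single (w l) 1) 1 := by
    rw [monomial_sum_one]
    rfl
  rw [this, coeff_monomial]

lemma sum_single_apply {N : ℕ} (w : Fin N → Fin k) (i : Fin k) :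
    (∑ l, Finsupp.single (w l) 1 : Fin k →₀ ℕ) i = (univ.filter (fun l => w l = i)).card := by
  rw [Finsupp.finsetSum_apply, card_filter]
  refine sum_congr rfl fun l _ => ?_
  rw [Finsupp.single_apply]

def constExp (k d : ℕ) : Fin k →₀ ℕ := Finsupp.equivFunOnFinite.symm (fun _ => d)

lemma word_eq {N : ℕ} (w : Fin N → Fin k) :
    (∑ l, Finsupp.single (w l) 1 : Fin k →₀ ℕ) = constExp k d ↔
      ∀ i, (univ.filter (fun l => w l = i)).card = d := by
  rw [DFunLike.ext_iff]
  simp only [sum_single_apply]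
  rfl

lemma word_eval (hL : Even L) (hL0 : 0 < L) {N : ℕ} (hN : N = k * d) (w : Fin N → Fin k) :
    pathSum N (fun l => cob (KK k d L) (tau (w l, 0))) (fun τ => TT τ * psi τ) =
      if (∑ l, Finsupp.single (w l) 1 : Fin k →₀ ℕ) = constExp k d then 1 else 0 := by
  classical
  -- ranks within fibres
  let S : Fin k → Finset (Fin N) := fun i => univ.filter (fun l => w l = i)
  let e : ∀ i, S i ≃ Fin (S i).card := fun i => (S i).equivFin
  have hmem : ∀ l, l ∈ S (w l) := fun l => by simp [S]
  let c : Fin N → ℕ := fun l => e (w l) ⟨l, hmem l⟩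
  have hc_lt : ∀ l, c l < (S (w l)).card := fun l => (e (w l) ⟨l, hmem l⟩).2
  have hc_inj : ∀ l l', w l = w l' → c l = c l' → l = l' := by
    intro l l' h1 h2
    have key : ∀ (i i' : Fin k) (hi : l ∈ S i) (hi' : l' ∈ S i'), i = i' →
        (e i ⟨l, hi⟩ : ℕ) = (e i' ⟨l', hi'⟩ : ℕ) → l = l' := by
      rintro i _ hi hi' rfl h
      have := (e i).injective (Fin.ext h)
      simpa using this
    exact key _ _ (hmem l) (hmem l') h1 h2
  have hc_surj : ∀ i n, n < (S i).card → ∃ l, w l = i ∧ c l = n := by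
    intro i n hn
    let y := (e i).symm ⟨n, hn⟩
    have hy : w y.1 = i := (mem_filter.mp y.2).2
    refine ⟨y.1, hy, ?_⟩
    have key : ∀ (i' : Fin k) (hi' : y.1 ∈ S i'), i' = i → (e i' ⟨y.1, hi'⟩ : ℕ) = n := by
      rintro _ hi' rfl
      show ((e _ y : Fin _) : ℕ) = n
      simp [y]
    exact key _ _ hy
  let w' : Fin N → J k d := fun l => (w l, ⟨min (c l) d, by omega⟩)
  rw [indepC hL hL0 N _ (fun l => tau (w' l)) (fun l g => g (w l))
    (fun l g σ => tau_act hL0 _ g σ) (fun l g σ => tau_act hL0 _ g σ)]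
  simp only [word_eq]
  have htot : ∑ i, (S i).card = k * d := by
    have := Finset.card_eq_sum_card_fiberwise (f := w) (s := univ) (t := univ) (by simp)
    rw [← hN]
    simpa using this.symm
  split_ifs with h
  · have h' : ∀ i, (S i).card = d := h
    apply eval_one hL hL0
    · intro l l' hll
      simp only [w', Prod.mk.injEq, Fin.mk.injEq] at hll
      have h1 := hc_lt l
      have h2 := hc_lt l'
      rw [h'] at h1 h2
      exact hc_inj l l' hll.1 (by omega)
    · intro l hl
      have h1 := hc_lt l
      rw [h'] at h1
      have := congrArg Fin.val hl
      simp [w'] at this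
      omega
    · rintro ⟨i, x⟩ hx
      have hx' : x.val < d := by
        have := x.2
        rcases Nat.lt_succ_iff_lt_or_eq.mp this with h | h
        · exact h
        · exact absurd (Fin.ext h) hx
      obtain ⟨l, h1, h2⟩ := hc_surj i x (by rw [h']; exact hx')
      refine ⟨l, ?_⟩
      simp only [w', h1, h2, Prod.mk.injEq, true_and]
      ext; simp; omega
  · have : ∃ i, d < (S i).card := by
      by_contra hcon
      push Not at hcon
      apply h
      have := (Finset.sum_eq_sum_iff_of_le (s := univ) (f := fun i => (S i).card)
        (g := fun _ : Fin k => d) (fun i _ => hcon i)).mp (by rw [htot]; simp)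
      intro i
      exact this i (mem_univ i)
    obtain ⟨i, hi⟩ := this
    apply eval_zero hL hL0 _ i
    intro x
    obtain ⟨l, h1, h2⟩ := hc_surj i x (by omega)
    refine ⟨l, ?_⟩
    simp only [w', h1, h2, Prod.mk.injEq, true_and]
    ext; simp; omega

lemma comb_path (hL : Even L) (hL0 : 0 < L) {N : ℕ} (χ : Fin N → Fin k → ZMod 2)
    (s : Fin N → Cell k d L → ZMod 2)
    (hs : ∀ l g σ, s l (act g σ) = s l σ + ∑ i, χ l i * g i)
    (hco : coeff (constExp k d) (∏ l, ∑ i, C (χ l i) * X i : MvPolynomial (Fin k) (ZMod 2)) ≠ 0) :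
    ∃ p : Fin (N + 1) → Cell k d L,
      (∀ l j, |(p l).1 j - (p (Fin.last N)).1 j| ≤ 1) ∧
      ∀ l : Fin N, s l (p l.castSucc) ≠ s l (p l.succ) := by
  rw [coeff_expand] at hco
  have hN : N = k * d := by
    obtain ⟨w, _, hw⟩ := exists_ne_zero_of_sum_ne_zero hco
    have h := right_ne_zero_of_mul hw
    have h' : (∑ l, Finsupp.single (w l) 1 : Fin k →₀ ℕ) = constExp k d := by
      by_contra hh; simp [hh] at h
    rw [word_eq] at h'
    have := Finset.card_eq_sum_card_fiberwise (f := w) (s := univ) (t := univ) (by simp)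
    simpa [h'] using this
  have hval : pathSum N (fun l => cob (KK k d L) (s l)) (fun τ => TT τ * psi τ) ≠ 0 := by
    rw [indepC hL hL0 N s (fun l σ => ∑ i, χ l i * tau (i, 0) σ) (fun l g => ∑ i, χ l i * g i) hs
      (by
        intro l g σ
        simp only [tau_act hL0, mul_add, sum_add_distrib])]
    rw [pathSum_expand]
    simp only [word_eval hL hL0 hN]
    exact hco
  obtain ⟨p, _, hp⟩ := exists_ne_zero_of_sum_ne_zero hval
  obtain ⟨h1, h2, _, _⟩ := path_cov hp
  refine ⟨p, fun l j => ?_, h2⟩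
  rcases path_le h1 l j with h | h
  · rw [h]; simp
  · exact h.2.2

end PH

namespace PH

open Finset MvPolynomial

variable {k d : ℕ}

lemma cs_eq_of_close (u v δ : ℝ) (hu : δ ≤ |u|) (h : |v - u| < δ) (e e' : ZMod 2) :
    cs v e = cs u e' := by
  unfold cs
  rw [abs_lt] at h
  rcases abs_cases u with ⟨h1, h2⟩ | ⟨h1, h2⟩
  · rw [if_pos (by linarith), if_pos (by linarith)]
  · rw [if_neg (by linarith), if_pos (by linarith), if_neg (by linarith), if_pos (by linarith)]

theorem borsuk_fin {N : ℕ} (χ : Fin N → Fin k → ZMod 2)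
    (hco : coeff (constExp k d) (∏ l, ∑ i, C (χ l i) * X i : MvPolynomial (Fin k) (ZMod 2)) ≠ 0)
    (f : Fin N → (J k d → ℝ) → ℝ) (hf : ∀ l, Continuous (f l))
    (heq : ∀ l (g : Fin k → ZMod 2) x, f l (fun j => (sgn (g j.1) : ℝ) * x j) =
      (sgn (∑ i, χ l i * g i) : ℝ) * f l x) :
    ∃ x : J k d → ℝ, (∀ i, ∃ c, x (i, c) ≠ 0) ∧ ∀ l, f l x = 0 := by
  by_contra hcon
  push Not at hcon
  let S : Set (J k d → ℝ) := {x | (∀ j, |x j| ≤ 1) ∧ ∀ i, ∃ c, |x (i, c)| = 1}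
  have hSball : S ⊆ Metric.closedBall 0 1 := by
    intro x hx
    rw [mem_closedBall_zero_iff, pi_norm_le_iff_of_nonneg zero_le_one]
    exact hx.1
  have hSclosed : IsClosed S := by
    have : S = (⋂ j, {x : J k d → ℝ | |x j| ≤ 1}) ∩
        ⋂ i, ⋃ c, {x : J k d → ℝ | |x (i, c)| = 1} := by
      ext x; simp [S]
    rw [this]
    refine IsClosed.inter (isClosed_iInter fun j => ?_) (isClosed_iInter fun i =>
      isClosed_iUnion_of_finite fun c => ?_)
    · exact isClosed_le (by fun_prop) (by fun_prop)
    · exact isClosed_eq (by fun_prop) (by fun_prop)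
  have hball : IsCompact (Metric.closedBall (0 : J k d → ℝ) 1) := isCompact_closedBall _ _
  have hScpt : IsCompact S := hball.of_isClosed_subset hSclosed hSball
  let Φ : (J k d → ℝ) → (Fin N → ℝ) := fun x l => f l x
  have hΦ : Continuous Φ := continuous_pi hf
  obtain ⟨δ, hδ, hδS⟩ := hScpt.exists_forall_le' (f := fun x => ‖Φ x‖) (a := 0)
    hΦ.norm.continuousOn (by
      intro x hx
      obtain ⟨l, hl⟩ := hcon x (fun i => by
        obtain ⟨c, hc⟩ := hx.2 i
        refine ⟨c, fun h => ?_⟩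
        rw [h] at hc; simp at hc)
      rw [norm_pos_iff]
      intro h
      exact hl (congrFun h l))
  have hun := hball.uniformContinuousOn_of_continuous hΦ.continuousOn
  rw [Metric.uniformContinuousOn_iff] at hun
  obtain ⟨η, hη, hun⟩ := hun δ hδ
  obtain ⟨n, hn⟩ := exists_nat_one_div_lt hη
  let L : ℤ := 2 * (n + 1)
  have hL : Even L := even_two_mul _
  have hL0 : 0 < L := by positivity
  have hLR : (0 : ℝ) < L := by exact_mod_cast hL0
  have hLη : 1 / (L : ℝ) < η := by
    refine lt_of_le_of_lt ?_ hn
    apply one_div_le_one_div_of_le (by positivity)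
    simp only [L]; push_cast; linarith
  let pt : Cell k d L → (J k d → ℝ) := fun σ j => (σ.1 j : ℝ) / L
  have hptS : ∀ σ, pt σ ∈ S := by
    intro σ
    have habs : ∀ j, |pt σ j| = ((|σ.1 j| : ℤ) : ℝ) / L := by
      intro j
      simp only [pt]
      rw [abs_div, abs_of_pos hLR, Int.cast_abs]
    refine ⟨fun j => ?_, fun i => ?_⟩
    · rw [habs, div_le_one hLR]
      exact_mod_cast σ.2.1 j
    · obtain ⟨c, hc⟩ := σ.2.2 i
      exact ⟨c, by rw [habs, hc, div_self hLR.ne']⟩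
  let s : Fin N → Cell k d L → ZMod 2 := fun l σ =>
    cs (f l (pt σ)) (∑ i, χ l i * tau (i, 0) σ)
  obtain ⟨p, hp1, hp2⟩ := comb_path hL hL0 χ s (by
    intro l g σ
    simp only [s, tau_act hL0, mul_add, sum_add_distrib]
    rw [← cs_sgn, ← heq]
    congr 2
    ext j
    simp only [pt, act_apply]
    push_cast
    ring) hco
  have hx := hδS _ (hptS (p (Fin.last N)))
  have : ∃ l, δ ≤ |f l (pt (p (Fin.last N)))| := by
    by_contra hc
    push Not at hc
    exact absurd ((pi_norm_lt_iff hδ).mpr hc) (not_lt.mpr hx)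
  obtain ⟨l, hl⟩ := this
  have key : ∀ n, |f l (pt (p n)) - f l (pt (p (Fin.last N)))| < δ := by
    intro n
    have h1 : dist (pt (p n)) (pt (p (Fin.last N))) < η := by
      refine lt_of_le_of_lt ?_ hLη
      rw [dist_pi_le_iff (by positivity)]
      intro j
      simp only [pt]
      rw [Real.dist_eq, ← sub_div, abs_div, abs_of_pos hLR]
      apply div_le_div_of_nonneg_right _ hLR.le
      exact_mod_cast hp1 n j
    have h2 := hun _ (hSball (hptS (p n))) _ (hSball (hptS (p (Fin.last N)))) h1
    rw [dist_pi_lt_iff hδ] at h2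
    exact h2 l
  apply hp2 l
  exact (cs_eq_of_close _ _ δ hl (key _) _ 0).trans (cs_eq_of_close _ _ δ hl (key _) _ 0).symm

theorem borsuk {ι : Type} [Fintype ι] (χ : ι → Fin k → ZMod 2)
    (hco : coeff (constExp k d) (∏ l, ∑ i, C (χ l i) * X i : MvPolynomial (Fin k) (ZMod 2)) ≠ 0)
    (f : ι → (J k d → ℝ) → ℝ) (hf : ∀ l, Continuous (f l))
    (heq : ∀ l (g : Fin k → ZMod 2) x, f l (fun j => (sgn (g j.1) : ℝ) * x j) =
      (sgn (∑ i, χ l i * g i) : ℝ) * f l x) :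
    ∃ x : J k d → ℝ, (∀ i, ∃ c, x (i, c) ≠ 0) ∧ ∀ l, f l x = 0 := by
  let e := (Fintype.equivFin ι).symm
  obtain ⟨x, h1, h2⟩ := borsuk_fin (fun l => χ (e l)) (by
    rw [e.prod_comp (fun l => ∑ i, C (χ l i) * X i : ι → MvPolynomial (Fin k) (ZMod 2))]
    exact hco) (fun l => f (e l)) (fun l => hf _) (fun l => heq _)
  refine ⟨x, h1, fun l => ?_⟩
  have := h2 (e.symm l)
  simpa using this

end PH

namespace PH

open Finset MvPolynomial

abbrev Idx (k m M : ℕ) := (Fin m × Fin k) ⊕ ((Fin M × {p : Fin k × Fin k // p.1 < p.2}) ⊕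
  (Σ i : Fin k, Fin i.val))

def chi {k m M : ℕ} : Idx k m M → Fin k → ZMod 2
  | Sum.inl (_, i) => Pi.single i 1
  | Sum.inr (Sum.inl (_, p)) => Pi.single p.1.1 1 + Pi.single p.1.2 1
  | Sum.inr (Sum.inr ⟨i, _⟩) => Pi.single i 1

lemma sum_single {k : ℕ} (i : Fin k) :
    (∑ i', C ((Pi.single i 1 : Fin k → ZMod 2) i') * X i' : MvPolynomial (Fin k) (ZMod 2)) = X i := by
  rw [sum_eq_single i]
  · simp
  · intro b _ hb; simp [hb]
  · simp

lemma sum_single2 {k : ℕ} (i j : Fin k) :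
    (∑ i', C ((Pi.single i 1 + Pi.single j 1 : Fin k → ZMod 2) i') * X i' :
      MvPolynomial (Fin k) (ZMod 2)) = X j - X i := by
  simp only [Pi.add_apply, map_add, add_mul, sum_add_distrib, sum_single]
  rw [CharTwo.sub_eq_add, add_comm]

lemma prod_pairs {k : ℕ} {R : Type} [CommRing R] (f : Fin k → Fin k → R) :
    ∏ p : {p : Fin k × Fin k // p.1 < p.2}, f p.1.1 p.1.2 = ∏ i, ∏ j ∈ Ioi i, f i j := by
  rw [Finset.prod_sigma']
  refine Finset.prod_bij' (fun p _ => ⟨p.1.1, p.1.2⟩)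
    (fun p hp => ⟨(p.1, p.2), by simpa using hp⟩) ?_ ?_ ?_ ?_ ?_
  · intro p _; simpa using p.2
  · intro p _; simp
  · intro p _; rfl
  · intro p _; rfl
  · intro p _; rfl

lemma coeff_ne (q t k : ℕ) (ht1 : 1 ≤ t) (ht2 : t ≤ 2 ^ q) (hk : 2 ≤ k)
    (m d : ℕ) (hm : m = 2 ^ (q + 1) - t) (hd : d = 2 ^ q * (k + 1) - t) :
    coeff (constExp k d) (∏ l : Idx k m (2 ^ (q + 1) - 1), ∑ i, C (chi l i) * X i :
      MvPolynomial (Fin k) (ZMod 2)) ≠ 0 := by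
  have h1 : (∏ l : Idx k m (2 ^ (q + 1) - 1), ∑ i, C (chi l i) * X i :
      MvPolynomial (Fin k) (ZMod 2)) =
      monomial (Finsupp.equivFunOnFinite.symm (fun i : Fin k => m + i.val)) 1 *
        Vd k (ZMod 2) ^ (2 ^ (q + 1) - 1) := by
    rw [Fintype.prod_sum_type, Fintype.prod_sum_type]
    simp only [chi, sum_single, sum_single2]
    rw [Fintype.prod_prod_type, Fintype.prod_prod_type, Fintype.prod_sigma]
    simp only [prod_const, card_univ, Fintype.card_fin]
    have h2 : ∏ x : {p : Fin k × Fin k // p.1 < p.2},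
        (X x.1.2 - X x.1.1 : MvPolynomial (Fin k) (ZMod 2)) = Vd k (ZMod 2) :=
      prod_pairs (fun i j => (X j - X i : MvPolynomial (Fin k) (ZMod 2)))
    rw [h2]
    rw [mul_comm (Vd k (ZMod 2) ^ _), ← mul_assoc]
    congr 1
    rw [← Finset.prod_pow, ← prod_mul_distrib, monomial_eq, C_1, one_mul, Finsupp.prod_fintype]
    · refine prod_congr rfl fun i _ => ?_
      rw [← pow_add]; rfl
    · intro i; simp
  have h3 : constExp k d = Finsupp.equivFunOnFinite.symm (fun i : Fin k => m + i.val) +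
      lowExp k q 1 := by
    ext i
    have hi := i.2
    simp only [constExp, lowExp, Finsupp.add_apply, Finsupp.equivFunOnFinite_symm_apply_apply,
      Equiv.Perm.coe_one, id]
    obtain ⟨k', rfl⟩ : ∃ k', k = k' + 1 := ⟨k - 1, by omega⟩
    have : k' ≤ 2 ^ q * k' := Nat.le_mul_of_pos_left _ (by positivity)
    have e1 : 2 ^ (q + 1) = 2 * 2 ^ q := by ring
    have e2 : 2 ^ q * (k' + 1 + 1) = 2 ^ q * k' + 2 * 2 ^ q := by ring
    rw [hd, hm, e1, e2, Nat.add_sub_cancel]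
    omega
  rw [h1, h3, coeff_monomial_mul, coeff_main]
  simp

end PH

namespace PH

open Finset

section geom
variable {d : ℕ}

/-- the affine function with parameters `v` -/
def AA (v : Fin (d + 1) → ℝ) (y : EuclideanSpace ℝ (Fin d)) : ℝ :=
  ∑ c : Fin d, v c.castSucc * y c - v (Fin.last d)

lemma AA_neg (v : Fin (d + 1) → ℝ) (y : EuclideanSpace ℝ (Fin d)) : AA (-v) y = - AA v y := by
  simp only [AA, Pi.neg_apply, neg_mul, sum_neg_distrib]; ring

lemma AA_cont : Continuous (fun p : (Fin (d + 1) → ℝ) × EuclideanSpace ℝ (Fin d) => AA p.1 p.2) := by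
  unfold AA; fun_prop

/-- positive part of the minimum of the affine function on `K` -/
def mm (K : Set (EuclideanSpace ℝ (Fin d))) (v : Fin (d + 1) → ℝ) : ℝ := max 0 (sInf (AA v '' K))

lemma mm_cont {K : Set (EuclideanSpace ℝ (Fin d))} (hK : IsCompact K) : Continuous (mm K) := by
  unfold mm
  exact continuous_const.max (hK.continuous_sInf (f := AA) AA_cont)

lemma mm_nonneg (K : Set (EuclideanSpace ℝ (Fin d))) (v : Fin (d + 1) → ℝ) : 0 ≤ mm K v :=
  le_max_left _ _

lemma mm_pos {K : Set (EuclideanSpace ℝ (Fin d))} (hK : IsCompact K) (hne : K.Nonempty)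
    (v : Fin (d + 1) → ℝ) : 0 < mm K v ↔ ∀ y ∈ K, 0 < AA v y := by
  have hc : Continuous (AA v) := AA_cont.comp (Continuous.prodMk_right v)
  have hcp : IsCompact (AA v '' K) := hK.image hc
  unfold mm
  rw [lt_max_iff]
  simp only [lt_irrefl, false_or]
  constructor
  · intro h y hy
    exact lt_of_lt_of_le h (csInf_le hcp.bddBelow ⟨y, hy, rfl⟩)
  · intro h
    obtain ⟨y, hy, hy2⟩ := hcp.sInf_mem (hne.image _)
    rw [← hy2]; exact h y hy

def oo (K : Set (EuclideanSpace ℝ (Fin d))) (v : Fin (d + 1) → ℝ) : ℝ := mm K v - mm K (-v)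

lemma oo_neg (K : Set (EuclideanSpace ℝ (Fin d))) (v : Fin (d + 1) → ℝ) : oo K (-v) = - oo K v := by
  simp [oo]

lemma oo_pos {K : Set (EuclideanSpace ℝ (Fin d))} (hK : IsCompact K) (hne : K.Nonempty)
    {v : Fin (d + 1) → ℝ} (h : 0 < oo K v) : 0 < mm K v := by
  have := mm_nonneg K (-v)
  unfold oo at h; linarith

lemma oo_lt {K : Set (EuclideanSpace ℝ (Fin d))} (hK : IsCompact K) (hne : K.Nonempty)
    {v : Fin (d + 1) → ℝ} (h : oo K v < 0) : 0 < mm K (-v) := by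
  have := mm_nonneg K v
  unfold oo at h; linarith

lemma oo_zero {K : Set (EuclideanSpace ℝ (Fin d))} (hK : IsCompact K) (hne : K.Nonempty)
    (hcv : Convex ℝ K) {v : Fin (d + 1) → ℝ} (h : oo K v = 0) : ∃ y ∈ K, AA v y = 0 := by
  have hc : Continuous (AA v) := AA_cont.comp (Continuous.prodMk_right v)
  obtain ⟨y0, hy0⟩ := hne
  have h1 : ¬ ∀ y ∈ K, 0 < AA v y := by
    intro h1
    have h2 := (mm_pos hK ⟨y0, hy0⟩ v).mpr h1
    have h3 : 0 < mm K (-v) := by unfold oo at h; linarith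
    have h4 := (mm_pos hK ⟨y0, hy0⟩ (-v)).mp h3 y0 hy0
    have h5 := h1 y0 hy0
    rw [AA_neg] at h4; linarith
  have h2 : ¬ ∀ y ∈ K, 0 < AA (-v) y := by
    intro h1
    have h2 := (mm_pos hK ⟨y0, hy0⟩ (-v)).mpr h1
    have h3 : 0 < mm K v := by unfold oo at h; linarith
    have h4 := (mm_pos hK ⟨y0, hy0⟩ v).mp h3 y0 hy0
    have h5 := h1 y0 hy0
    rw [AA_neg] at h5; linarith
  push Not at h1 h2
  obtain ⟨a, ha, ha2⟩ := h1
  obtain ⟨b, hb, hb2⟩ := h2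
  rw [AA_neg] at hb2
  have := hcv.isPreconnected.intermediate_value ha hb hc.continuousOn
  obtain ⟨y, hy, hy2⟩ := this ⟨ha2, by linarith⟩
  exact ⟨y, hy, hy2⟩

lemma disj_of_opp {K L : Set (EuclideanSpace ℝ (Fin d))} (hK : IsCompact K) (hKne : K.Nonempty)
    (hL : IsCompact L) (hLne : L.Nonempty) {v : Fin (d + 1) → ℝ} (h1 : 0 < mm K v)
    (h2 : 0 < mm L (-v)) : Disjoint K L := by
  rw [Set.disjoint_left]
  intro y hy hy'
  have a := (mm_pos hK hKne v).mp h1 y hy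
  have b := (mm_pos hL hLne (-v)).mp h2 y hy'
  rw [AA_neg] at b; linarith

open Classical in
def gg (F : Finset (Set (EuclideanSpace ℝ (Fin d)))) (v : Fin (d + 1) → ℝ) : ℝ :=
  ∑ K ∈ F, ∑ L ∈ F, if Disjoint K L then mm K v * mm L v else 0

variable {F : Finset (Set (EuclideanSpace ℝ (Fin d)))}
  (hne : ∀ A ∈ F, A.Nonempty) (hcpt : ∀ A ∈ F, IsCompact A) (hcvx : ∀ A ∈ F, Convex ℝ A)
  (hdisj : ∀ G : Finset (Set (EuclideanSpace ℝ (Fin d))), G ⊆ F → G.card = 4 →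
        ¬ (∀ A ∈ G, ∀ B ∈ G, A ≠ B → Disjoint A B))

include hcpt in
lemma gg_cont : Continuous (gg F) := by
  classical
  unfold gg
  refine continuous_finset_sum _ fun K hK => continuous_finset_sum _ fun L hL => ?_
  split_ifs
  · exact (mm_cont (hcpt K hK)).mul (mm_cont (hcpt L hL))
  · exact continuous_const

lemma gg_nonneg (v : Fin (d + 1) → ℝ) : 0 ≤ gg F v := by
  classical
  unfold gg
  refine sum_nonneg fun K _ => sum_nonneg fun L _ => ?_
  split_ifs
  · exact mul_nonneg (mm_nonneg _ _) (mm_nonneg _ _)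
  · exact le_rfl

lemma gg_pos_iff (v : Fin (d + 1) → ℝ) : 0 < gg F v ↔
    ∃ K ∈ F, ∃ L ∈ F, Disjoint K L ∧ 0 < mm K v ∧ 0 < mm L v := by
  classical
  have hnn : ∀ K L, 0 ≤ if Disjoint K L then mm K v * mm L v else 0 := by
    intro K L
    split_ifs
    · exact mul_nonneg (mm_nonneg _ _) (mm_nonneg _ _)
    · exact le_rfl
  unfold gg
  rw [sum_pos_iff_of_nonneg (fun K _ => sum_nonneg fun L _ => hnn K L)]
  refine exists_congr fun K => and_congr_right fun _ => ?_
  rw [sum_pos_iff_of_nonneg (fun L _ => hnn K L)]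
  refine exists_congr fun L => and_congr_right fun _ => ?_
  have a := mm_nonneg K v
  have b := mm_nonneg L v
  split_ifs with h
  · simp only [h, true_and]
    constructor
    · intro h
      exact ⟨pos_of_mul_pos_left h b, pos_of_mul_pos_right h a⟩
    · rintro ⟨h1, h2⟩; positivity
  · simp [h]

include hne hcpt hdisj in
lemma gg_zero {v : Fin (d + 1) → ℝ} (h : gg F v - gg F (-v) = 0) : gg F v = 0 ∧ gg F (-v) = 0 := by
  classical
  by_contra hcon
  have h0 := gg_nonneg (F := F) v
  have h0' := gg_nonneg (F := F) (-v)
  have h1 : 0 < gg F v := by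
    rcases h0.lt_or_eq with h | h
    · exact h
    · exact absurd ⟨h.symm, by linarith⟩ hcon
  have h2 : 0 < gg F (-v) := by linarith
  rw [gg_pos_iff] at h1 h2
  obtain ⟨A, hA, B, hB, hAB, pA, pB⟩ := h1
  obtain ⟨C, hC, D, hD, hCD, pC, pD⟩ := h2
  have opp : ∀ K ∈ F, ∀ L ∈ F, 0 < mm K v → 0 < mm L (-v) → Disjoint K L := fun K hK L hL a b =>
    disj_of_opp (hcpt K hK) (hne K hK) (hcpt L hL) (hne L hL) a b
  have hAC := opp A hA C hC pA pC
  have hAD := opp A hA D hD pA pD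
  have hBC := opp B hB C hC pB pC
  have hBD := opp B hB D hD pB pD
  have ne : ∀ K ∈ F, ∀ L, Disjoint K L → K ≠ L := by
    rintro K hK _ hd rfl
    rw [disjoint_self] at hd
    exact (hne K hK).ne_empty hd
  apply hdisj {A, B, C, D}
  · intro K hK
    simp only [mem_insert, mem_singleton] at hK
    rcases hK with rfl | rfl | rfl | rfl <;> assumption
  · have n1 := ne A hA B hAB
    have n2 := ne A hA C hAC
    have n3 := ne A hA D hAD
    have n4 := ne B hB C hBC
    have n5 := ne B hB D hBD
    have n6 := ne C hC D hCD
    rw [card_insert_of_notMem, card_insert_of_notMem, card_insert_of_notMem, card_singleton] <;>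
      simp [*]
  · intro K hK L hL hKL
    simp only [mem_insert, mem_singleton] at hK hL
    rcases hK with rfl | rfl | rfl | rfl <;> rcases hL with rfl | rfl | rfl | rfl <;>
      first | exact absurd rfl hKL | assumption | (apply Disjoint.symm; assumption)

lemma not_disj {v : Fin (d + 1) → ℝ} (h : gg F v = 0) {K L} (hK : K ∈ F) (hL : L ∈ F)
    (h1 : 0 < mm K v) (h2 : 0 < mm L v) : ¬ Disjoint K L := by
  intro hd
  have := (gg_pos_iff (F := F) v).mpr ⟨K, hK, L, hL, hd, h1, h2⟩
  linarith

include hne hcpt hdisj in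
lemma prod_zero {v w : Fin (d + 1) → ℝ} (hv : gg F v - gg F (-v) = 0)
    (hw : gg F w - gg F (-w) = 0) (hs : ∑ K ∈ F, oo K v * oo K w = 0) :
    ∀ K ∈ F, oo K v * oo K w = 0 := by
  obtain ⟨v1, v2⟩ := gg_zero hne hcpt hdisj hv
  obtain ⟨w1, w2⟩ := gg_zero hne hcpt hdisj hw
  have opp : ∀ u, ∀ K ∈ F, ∀ L ∈ F, 0 < mm K u → 0 < mm L (-u) → Disjoint K L :=
    fun u K hK L hL a b =>
    disj_of_opp (hcpt K hK) (hne K hK) (hcpt L hL) (hne L hL) a b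
  have key : ∀ K ∈ F, ∀ L ∈ F, 0 < oo K v * oo K w → oo L v * oo L w < 0 → False := by
    intro K hK L hL h1 h2
    have P := fun u => oo_pos (hcpt K hK) (hne K hK) (v := u)
    have M := fun u => oo_lt (hcpt K hK) (hne K hK) (v := u)
    have P' := fun u => oo_pos (hcpt L hL) (hne L hL) (v := u)
    have M' := fun u => oo_lt (hcpt L hL) (hne L hL) (v := u)
    rcases mul_pos_iff.mp h1 with ⟨a, b⟩ | ⟨a, b⟩ <;>
      rcases mul_neg_iff.mp h2 with ⟨a', b'⟩ | ⟨a', b'⟩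
    · exact not_disj v1 hK hL (P _ a) (P' _ a') (opp w K hK L hL (P _ b) (M' _ b'))
    · exact not_disj w1 hK hL (P _ b) (P' _ b') (opp v K hK L hL (P _ a) (M' _ a'))
    · exact not_disj w2 hK hL (M _ b) (M' _ b') (opp v L hL K hK (P' _ a') (M _ a)).symm
    · exact not_disj v2 hK hL (M _ a) (M' _ a') (opp w L hL K hK (P' _ b') (M _ b)).symm
  by_cases hp : ∃ K ∈ F, 0 < oo K v * oo K w
  · obtain ⟨K, hK, hK2⟩ := hp
    refine (sum_eq_zero_iff_of_nonneg fun L hL => ?_).mp hs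
    by_contra hc
    exact key K hK L hL hK2 (not_le.mp hc)
  · push Not at hp
    exact (sum_eq_zero_iff_of_nonpos hp).mp hs

end geom

lemma odd_sgn {V : Type} [AddCommGroup V] [Module ℝ V] (h : V → ℝ) (hodd : ∀ v, h (-v) = - h v)
    (a : ZMod 2) (v : V) : h ((sgn a : ℝ) • v) = (sgn a : ℝ) * h v := by
  rcases zmod2_cases a with rfl | rfl <;> simp [sgn, hodd]

lemma sgn_add (a b : ZMod 2) : sgn (a + b) = sgn a * sgn b := by revert a b; decide

/-- block of parameters -/
def blk {k d : ℕ} (x : J k d → ℝ) (i : Fin k) : Fin (d + 1) → ℝ := fun c => x (i, c)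

lemma blk_sgn {k d : ℕ} (x : J k d → ℝ) (g : Fin k → ZMod 2) (i : Fin k) :
    blk (fun j => (sgn (g j.1) : ℝ) * x j) i = (sgn (g i) : ℝ) • blk x i := rfl

lemma blk_cont {k d : ℕ} (i : Fin k) : Continuous (fun x : J k d → ℝ => blk x i) := by
  unfold blk; fun_prop

def ff {k d m M : ℕ} (F : ℕ → Finset (Set (EuclideanSpace ℝ (Fin d)))) :
    Idx k m M → (J k d → ℝ) → ℝ
  | Sum.inl (r, i) => fun x => gg (F r) (blk x i) - gg (F r) (-blk x i)
  | Sum.inr (Sum.inl (r, p)) => fun x => ∑ K ∈ F r, oo K (blk x p.1.1) * oo K (blk x p.1.2)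
  | Sum.inr (Sum.inr _) => fun _ => 0

lemma main_zero (q t k : ℕ) (ht1 : 1 ≤ t) (ht2 : t ≤ 2 ^ q) (hk : 2 ≤ k)
    (m d : ℕ) (hm : m = 2 ^ (q + 1) - t) (hd : d = 2 ^ q * (k + 1) - t)
    (F : ℕ → Finset (Set (EuclideanSpace ℝ (Fin d))))
    (hcpt : ∀ r, ∀ A ∈ F r, IsCompact A) :
    ∃ x : J k d → ℝ, (∀ i, blk x i ≠ 0) ∧
      (∀ r < m, ∀ i, gg (F r) (blk x i) - gg (F r) (-blk x i) = 0) ∧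
      ∀ r < m, ∀ i j, i < j → ∑ K ∈ F r, oo K (blk x i) * oo K (blk x j) = 0 := by
  obtain ⟨x, h1, h2⟩ := borsuk chi (coeff_ne q t k ht1 ht2 hk m d hm hd) (ff F) (by
    rintro (⟨r, i⟩ | ⟨r, p⟩ | _)
    · exact ((gg_cont (hcpt r)).comp (blk_cont i)).sub
        ((gg_cont (hcpt r)).comp (blk_cont i).neg)
    · refine continuous_finset_sum _ fun K hK => ?_
      have ho : Continuous (oo K) := by
        unfold oo
        exact (mm_cont (hcpt r K hK)).sub ((mm_cont (hcpt r K hK)).comp continuous_neg)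
      exact (ho.comp (blk_cont _)).mul (ho.comp (blk_cont _))
    · exact continuous_const) (by
    rintro (⟨r, i⟩ | ⟨r, p⟩ | ⟨i, _⟩) g x
    · simp only [ff, chi, blk_sgn]
      have : ∑ i', (Pi.single i 1 : Fin k → ZMod 2) i' * g i' = g i := by
        simp [Pi.single_apply]
      rw [this]
      exact odd_sgn (fun v => gg (F r) v - gg (F r) (-v)) (fun v => by simp) (g i) (blk x i)
    · simp only [ff, chi, blk_sgn]
      have : ∑ i', (Pi.single p.1.1 1 + Pi.single p.1.2 1 : Fin k → ZMod 2) i' * g i' =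
          g p.1.1 + g p.1.2 := by
        simp [Pi.single_apply, add_mul, sum_add_distrib]
      rw [this, mul_sum, sgn_add]
      refine sum_congr rfl fun K _ => ?_
      rw [odd_sgn _ (oo_neg K), odd_sgn _ (oo_neg K)]
      push_cast; ring
    · simp [ff])
  refine ⟨x, fun i h => ?_, fun r hr i => ?_, fun r hr i j hij => ?_⟩
  · obtain ⟨c, hc⟩ := h1 i
    exact hc (congrFun h c)
  · exact h2 (Sum.inl (⟨r, hr⟩, i))
  · exact h2 (Sum.inr (Sum.inl (⟨r, by omega⟩, ⟨(i, j), hij⟩)))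

end PH

theorem stmt_11 (q t k : ℕ) (ht1 : 1 ≤ t) (ht2 : t ≤ 2 ^ q) (hk : 2 ≤ k)
    (m d : ℕ) (hm : m = 2 ^ (q + 1) - t) (hd : d = 2 ^ q * (k + 1) - t)
    (F : Fin m → Finset (Set (EuclideanSpace ℝ (Fin d))))
    (hne : ∀ r, ∀ A ∈ F r, A.Nonempty)
    (hcpt : ∀ r, ∀ A ∈ F r, IsCompact A)
    (hcvx : ∀ r, ∀ A ∈ F r, Convex ℝ A)
    -- no four members of any single family are pairwise disjoint
    (hdisj : ∀ r, ∀ G : Finset (Set (EuclideanSpace ℝ (Fin d))),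
      G ⊆ F r → G.card = 4 →
        ¬ (∀ A ∈ G, ∀ B ∈ G, A ≠ B → Disjoint A B)) :
    ∃ (a : Fin k → EuclideanSpace ℝ (Fin d)) (b : Fin k → ℝ),
      (∀ i, a i ≠ 0) ∧
      ∀ i j : Fin k, i < j → ∀ r : Fin m, ∀ A ∈ F r,
        ((hyperplane (a i) (b i) ∪ hyperplane (a j) (b j)) ∩ A).Nonempty := by
  classical
  have hd1 : 0 < d := by
    have h1 : 2 ^ q * (k + 1) = 2 ^ q * k + 2 ^ q := by ring
    have h2 : 0 < 2 ^ q * k := by positivity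
    omega
  obtain ⟨x, hx0, hx1, hx2⟩ := PH.main_zero q t k ht1 ht2 hk m d hm hd
    (fun r => if h : r < m then F ⟨r, h⟩ else ∅) (by
      intro r A hA
      by_cases h : r < m
      · simp only [h, dif_pos] at hA; exact hcpt _ A hA
      · simp [h] at hA)
  let e0 : EuclideanSpace ℝ (Fin d) := EuclideanSpace.single ⟨0, hd1⟩ 1
  have he0 : e0 ≠ 0 := by
    intro h
    have := congrArg (fun v : EuclideanSpace ℝ (Fin d) => v ⟨0, hd1⟩) h
    simp [e0] at this
  let a0 : Fin k → EuclideanSpace ℝ (Fin d) := fun i =>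
    WithLp.toLp 2 (fun c => PH.blk x i c.castSucc)
  let a : Fin k → EuclideanSpace ℝ (Fin d) := fun i => if a0 i = 0 then e0 else a0 i
  let b : Fin k → ℝ := fun i => PH.blk x i (Fin.last d)
  have hAA : ∀ i y, PH.AA (PH.blk x i) y = ⟪a0 i, y⟫ - b i := by
    intro i y
    simp only [PH.AA, a0, b, PiLp.inner_apply]
    congr 1
    refine Finset.sum_congr rfl fun c _ => ?_
    simp [mul_comm]
  have hit : ∀ i r, ∀ A ∈ F r, PH.oo A (PH.blk x i) = 0 → ∃ y ∈ A, y ∈ hyperplane (a i) (b i) := by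
    intro i r A hA h
    obtain ⟨y, hy, hy2⟩ := PH.oo_zero (hcpt r A hA) (hne r A hA) (hcvx r A hA) h
    refine ⟨y, hy, ?_⟩
    rw [hAA] at hy2
    have ha0 : a0 i ≠ 0 := by
      intro h0
      apply hx0 i
      have hb : b i = 0 := by
        rw [h0, inner_zero_left] at hy2; linarith
      ext c
      induction c using Fin.lastCases with
      | last => exact hb
      | cast c =>
        exact congrArg (fun v : EuclideanSpace ℝ (Fin d) => v c) h0
    show ⟪a i, y⟫ = b i
    simp only [a, ha0, if_false]
    linarith
  refine ⟨a, b, fun i => ?_, fun i j hij r A hA => ?_⟩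
  · simp only [a]
    split_ifs with h
    · exact he0
    · exact h
  · have e1 := hx1 r r.2 i
    have e2 := hx1 r r.2 j
    have e3 := hx2 r r.2 i j hij
    simp only [r.2, dif_pos, Fin.eta] at e1 e2 e3
    have := PH.prod_zero (hne r) (hcpt r) (hdisj r) e1 e2 e3 A hA
    rcases mul_eq_zero.mp this with h | h
    · obtain ⟨y, hy, hy2⟩ := hit i r A hA h
      exact ⟨y, Or.inl hy2, hy⟩
    · obtain ⟨y, hy, hy2⟩ := hit j r A hA h
      exact ⟨y, Or.inr hy2, hy⟩
end
end

section
/- Let q ≥ 0 and 1 ≤ t ≤ 2^q be integers, let m = 2^{q+1} − t and d = 7·2^q − 2t. Let F_1, …, F_m be finite families of nonempty compact convex subsets of ℝ^d such that no eight members of any single family F_i are pairwise disjoint. Then there exist four hyperplanes H_1, H_2, H_3, H_4 in ℝ^d such that for every choice of indices 1 ≤ i_1 < i_2 < i_3 ≤ 4, the union H_{i_1} ∪ H_{i_2} ∪ H_{i_3} intersects every member of every family F_r; that is, every F_r is pierced by any three of the four hyperplanes. -/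
open RealInnerProductSpace

noncomputable section

namespace HP

/-- Cubical coboundary mod 2 on the Khalimsky grid. -/
def cob {ι : Type*} [Fintype ι] [DecidableEq ι] (F : (ι → ℤ) → ZMod 2) (v : ι → ℤ) : ZMod 2 :=
  ∑ c, if Odd (v c) then F (Function.update v c (v c + 1)) + F (Function.update v c (v c - 1))
    else 0

section
variable {ι : Type*} [Fintype ι] [DecidableEq ι]

lemma z2 (x : ZMod 2) : x + x = 0 := CharTwo.add_self_eq_zero x

lemma cob_one : cob (fun _ : ι → ℤ => (1 : ZMod 2)) = 0 := by
  funext v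
  simp only [cob, z2, ite_self, Finset.sum_const_zero, Pi.zero_apply]

lemma cob_add (F G : (ι → ℤ) → ZMod 2) : cob (F + G) = cob F + cob G := by
  funext v
  simp only [cob, Pi.add_apply, ← Finset.sum_add_distrib]
  refine Finset.sum_congr rfl fun c _ => ?_
  split_ifs
  · ring
  · simp

lemma sum_symm_zero (A : ι → ι → ZMod 2) (hd : ∀ c, A c c = 0) (hs : ∀ c c', A c c' = A c' c) :
    ∑ c, ∑ c', A c c' = 0 := by
  rw [← Fintype.sum_prod_type']
  refine Finset.sum_involution (fun p _ => p.swap) ?_ ?_ ?_ ?_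
  · rintro ⟨a, b⟩ _
    simp only [Prod.fst_swap, Prod.snd_swap]
    rw [hs b a, z2]
  · rintro ⟨a, b⟩ _ h1 h2
    simp only [Prod.swap_prod_mk, Prod.mk.injEq] at h2
    rw [h2.1] at h1
    exact h1 (hd _)
  · intros; simp
  · intros; simp

lemma cob_cob (F : (ι → ℤ) → ZMod 2) : cob (cob F) = 0 := by
  funext v
  simp only [cob, Pi.zero_apply]
  let B : ℤ → ℤ → ι → ι → ZMod 2 := fun x y c c' =>
    if c ≠ c' ∧ Odd (v c) ∧ Odd (v c') then
      F (Function.update (Function.update v c (v c + x)) c' (v c' + y)) else 0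
  have key : ∀ c x, (x = 1 ∨ x = -1) → Odd (v c) →
      (∑ c', if Odd (Function.update v c (v c + x) c') then
        F (Function.update (Function.update v c (v c + x)) c' (Function.update v c (v c + x) c' + 1))
        + F (Function.update (Function.update v c (v c + x)) c' (Function.update v c (v c + x) c' - 1))
        else 0) = ∑ c', (B x 1 c c' + B x (-1) c c') := by
    intro c x hx hc
    refine Finset.sum_congr rfl fun c' _ => ?_
    by_cases h : c = c'
    · subst h
      have : ¬ Odd (v c + x) := by
        rcases hx with rfl | rfl <;> rw [Int.not_odd_iff_even] <;> obtain ⟨k, hk⟩ := hc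
        · exact ⟨k + 1, by omega⟩
        · exact ⟨k, by omega⟩
      simp [B, this]
    · have h' : c' ≠ c := fun e => h e.symm
      simp only [Function.update_of_ne h', B, h, hc, true_and, ne_eq, not_false_eq_true, sub_eq_add_neg]
      split_ifs <;> simp
  have : ∀ c, (if Odd (v c) then
      (∑ c', if Odd (Function.update v c (v c + 1) c') then
        F (Function.update (Function.update v c (v c + 1)) c' (Function.update v c (v c + 1) c' + 1))
        + F (Function.update (Function.update v c (v c + 1)) c' (Function.update v c (v c + 1) c' - 1))
        else 0) +
      (∑ c', if Odd (Function.update v c (v c - 1) c') then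
        F (Function.update (Function.update v c (v c - 1)) c' (Function.update v c (v c - 1) c' + 1))
        + F (Function.update (Function.update v c (v c - 1)) c' (Function.update v c (v c - 1) c' - 1))
        else 0) else 0) = ∑ c', (B 1 1 c c' + B 1 (-1) c c' + (B (-1) 1 c c' + B (-1) (-1) c c')) := by
    intro c
    split_ifs with hc
    · rw [key c 1 (Or.inl rfl) hc]
      have := key c (-1) (Or.inr rfl) hc
      rw [← sub_eq_add_neg] at this
      rw [this, ← Finset.sum_add_distrib]
    · simp [B, hc]
  rw [Finset.sum_congr rfl fun c _ => this c]
  have hB : ∀ x y c c', B x y c c' = B y x c' c := by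
    intro x y c c'
    by_cases h : c = c'
    · subst h; simp [B]
    · simp only [B, ne_comm (a := c)]
      rw [Function.update_comm h]
      congr 1
      simp only [eq_iff_iff]
      tauto
  apply sum_symm_zero
  · intro c; simp [B]
  · intro c c'
    rw [hB 1 1 c c', hB 1 (-1) c c', hB (-1) 1 c c', hB (-1) (-1) c c']
    ring

/-- Iterated cochain. -/
def Fs (s : ℕ → (ι → ℤ) → ZMod 2) : ℕ → (ι → ℤ) → ZMod 2
  | 0 => fun _ => 1
  | j + 1 => cob (s j * Fs s j)

lemma cob_Fs (s : ℕ → (ι → ℤ) → ZMod 2) (j : ℕ) : cob (Fs s j) = 0 := by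
  cases j with
  | zero => exact cob_one
  | succ j => exact cob_cob _

lemma cob_mul_eq (r F : (ι → ℤ) → ZMod 2) (hF : cob F = 0) (v : ι → ℤ) :
    cob (r * F) v = ∑ c, if Odd (v c) then
      (r (Function.update v c (v c + 1)) + r v) * F (Function.update v c (v c + 1)) +
      (r (Function.update v c (v c - 1)) + r v) * F (Function.update v c (v c - 1)) else 0 := by
  have h : cob (r * F) v = cob (r * F) v + r v * cob F v := by simp [hF]
  rw [h]
  simp only [cob, Finset.mul_sum, ← Finset.sum_add_distrib, Pi.mul_apply]
  refine Finset.sum_congr rfl fun c _ => ?_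
  split_ifs
  · ring
  · simp

end

section blocks
variable {d : ℕ}

/-- negate block `i` -/
def neg (i : Fin 4) (v : Fin 4 × Fin d → ℤ) : Fin 4 × Fin d → ℤ :=
  fun c => if c.1 = i then - v c else v c

def Cube (n : ℤ) (v : Fin 4 × Fin d → ℤ) : Prop := ∀ c, |v c| ≤ 2 * n

def Bd (n : ℤ) (i : Fin 4) (v : Fin 4 × Fin d → ℤ) : Prop := ∃ k, |v (i, k)| = 2 * n

lemma neg_neg' (i : Fin 4) (v : Fin 4 × Fin d → ℤ) : neg i (neg i v) = v := by
  funext c; simp only [neg]; split_ifs <;> simp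

lemma neg_update (i : Fin 4) (v : Fin 4 × Fin d → ℤ) (c) (x : ℤ) :
    neg i (Function.update v c x) = Function.update (neg i v) c (if c.1 = i then - x else x) := by
  funext c'
  by_cases h : c' = c
  · subst h; simp [neg]
  · simp [neg, Function.update_of_ne h]

lemma cube_update {n : ℤ} {v : Fin 4 × Fin d → ℤ} (hv : Cube n v) {c} (hc : Odd (v c)) {x : ℤ}
    (hx : x = v c + 1 ∨ x = v c - 1) : Cube n (Function.update v c x) := by
  intro c'
  by_cases h : c' = c
  · subst h
    have := hv c'
    rw [abs_le] at this
    obtain ⟨k, hk⟩ := hc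
    simp only [Function.update_self]
    rw [abs_le]
    constructor <;> omega
  · rw [Function.update_of_ne h]; exact hv c'

lemma bd_update {n : ℤ} {i : Fin 4} {v : Fin 4 × Fin d → ℤ} (hv : Bd n i v) {c} (hc : Odd (v c))
    (x : ℤ) : Bd n i (Function.update v c x) := by
  obtain ⟨k, hk⟩ := hv
  refine ⟨k, ?_⟩
  rw [Function.update_of_ne, hk]
  rintro rfl
  obtain ⟨l, hl⟩ := hc
  rcases abs_eq_abs.1 (hk.trans (abs_of_nonneg (by rw [← hk]; exact abs_nonneg _)).symm) with h | h <;> omega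

lemma cob_neg {n : ℤ} {i : Fin 4} {H H' : (Fin 4 × Fin d → ℤ) → ZMod 2}
    (h : ∀ u, Cube n u → Bd n i u → H (neg i u) = H' u) {v} (hv : Cube n v) (hb : Bd n i v) :
    cob H (neg i v) = cob H' v := by
  simp only [cob]
  refine Finset.sum_congr rfl fun c _ => ?_
  have ho : Odd (neg i v c) ↔ Odd (v c) := by
    simp only [neg]; split_ifs <;> simp
  simp only [ho]
  split_ifs with hc
  · rw [← h _ (cube_update hv hc (Or.inl rfl)) (bd_update hb hc _),
      ← h _ (cube_update hv hc (Or.inr rfl)) (bd_update hb hc _), neg_update, neg_update]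
    by_cases hi : c.1 = i
    · simp only [neg, hi, if_true]
      rw [add_comm]
      congr 3 <;> ring
    · simp only [neg, hi, if_false]
  · rfl

/-- Twisted equivariance of a section. -/
def Equi (n : ℤ) (I : Finset (Fin 4)) (s : (Fin 4 × Fin d → ℤ) → ZMod 2) : Prop :=
  ∀ i v, Cube n v → Bd n i v → s (neg i v) = s v + if i ∈ I then 1 else 0

lemma Fs_inv {n : ℤ} {χ : ℕ → Finset (Fin 4)} {s : ℕ → (Fin 4 × Fin d → ℤ) → ZMod 2}
    (hs : ∀ j, Equi n (χ j) (s j)) (j : ℕ) : Equi n ∅ (Fs s j) := by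
  induction j with
  | zero => intro i v _ _; simp [Fs]
  | succ j ih =>
    intro i v hv hb
    simp only [Fs]
    have h0 := congrFun (cob_Fs s j) v
    rw [cob_neg (H' := s j * Fs s j + fun u => (if i ∈ χ j then 1 else 0) * Fs s j u) _ hv hb]
    · rw [cob_add]
      by_cases hi : i ∈ χ j
      · simp only [hi, if_true, one_mul]
        simpa using h0
      · simp only [hi, if_false, zero_mul]
        simp [cob]
    · intro u hu hbu
      have h1 := ih i u hu hbu
      simp only [Finset.notMem_empty, if_false, add_zero] at h1
      simp only [Pi.mul_apply, Pi.add_apply, h1, hs j i u hu hbu]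
      ring

/-- top cells -/
noncomputable def Top (n : ℕ) (b : Fin 4 →₀ ℕ) : Finset (Fin 4 × Fin d → ℤ) :=
  Fintype.piFinset fun c => if (c.2 : ℕ) < b c.1 then
    (Finset.Icc (-(2 * n : ℤ)) (2 * n)).filter (fun x => Odd x) else {0}

lemma mem_Top {n : ℕ} {b : Fin 4 →₀ ℕ} {v : Fin 4 × Fin d → ℤ} :
    v ∈ Top n b ↔ ∀ c, ((c.2 : ℕ) < b c.1 → Odd (v c) ∧ -(2 * n : ℤ) ≤ v c ∧ v c ≤ 2 * n) ∧
      (¬ (c.2 : ℕ) < b c.1 → v c = 0) := by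
  simp only [Top, Fintype.mem_piFinset]
  refine forall_congr' fun c => ?_
  split_ifs with h
  · simp [h]; tauto
  · simp [h]

lemma Top_cube {n : ℕ} {b : Fin 4 →₀ ℕ} {v : Fin 4 × Fin d → ℤ} (h : v ∈ Top n b) :
    Cube n v := by
  intro c
  have := (mem_Top.1 h c)
  by_cases hc : (c.2 : ℕ) < b c.1
  · exact abs_le.2 (this.1 hc).2
  · rw [this.2 hc]; simp

lemma Top_neg {n : ℕ} {b : Fin 4 →₀ ℕ} {v : Fin 4 × Fin d → ℤ} (i) (h : v ∈ Top n b) :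
    neg i v ∈ Top n b := by
  rw [mem_Top] at h ⊢
  intro c
  obtain ⟨h1, h2⟩ := h c
  simp only [neg]
  split_ifs
  · refine ⟨fun hc => ?_, fun hc => by rw [h2 hc]; simp⟩
    obtain ⟨a, b, c⟩ := h1 hc
    exact ⟨a.neg, by omega, by omega⟩
  · exact ⟨h1, h2⟩

lemma Top_update {n : ℕ} {b : Fin 4 →₀ ℕ} {v : Fin 4 × Fin d → ℤ} (h : v ∈ Top n b) {c} {x : ℤ}
    (hc : (c.2 : ℕ) < b c.1) (hx : Odd x ∧ -(2 * n : ℤ) ≤ x ∧ x ≤ 2 * n) :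
    Function.update v c x ∈ Top n b := by
  rw [mem_Top] at h ⊢
  intro c'
  by_cases e : c' = c
  · subst e; simp [hc, hx]
  · rw [Function.update_of_ne e]; exact h c'

lemma stokes_one {n : ℕ} {b : Fin 4 →₀ ℕ} {G : (Fin 4 × Fin d → ℤ) → ZMod 2}
    (hG : Equi n ∅ G) (c : Fin 4 × Fin d) (hc : (c.2 : ℕ) < b c.1) :
    ∑ v ∈ Top n b, G (Function.update v c (v c + 1)) =
      ∑ v ∈ Top n b, G (Function.update v c (v c - 1)) := by
  refine Finset.sum_nbij'
    (fun v => if v c + 1 = 2 * n then neg c.1 v else Function.update v c (v c + 2))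
    (fun v => if v c - 1 = - (2 * n) then neg c.1 v else Function.update v c (v c - 2)) ?_ ?_ ?_ ?_ ?_
  · intro v hv
    have h := ((mem_Top.1 hv) c).1 hc
    obtain ⟨⟨k, hk⟩, h2, h3⟩ := h
    split_ifs with h0
    · exact Top_neg _ hv
    · exact Top_update hv hc ⟨⟨k + 1, by omega⟩, by omega, by omega⟩
  · intro v hv
    have h := ((mem_Top.1 hv) c).1 hc
    obtain ⟨⟨k, hk⟩, h2, h3⟩ := h
    split_ifs with h0
    · exact Top_neg _ hv
    · exact Top_update hv hc ⟨⟨k - 1, by omega⟩, by omega, by omega⟩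
  · intro v hv
    have h := ((mem_Top.1 hv) c).1 hc
    obtain ⟨⟨k, hk⟩, h2, h3⟩ := h
    split_ifs with h0 h1 h1
    · rw [neg_neg']
    · simp [neg] at h1; omega
    · simp at h1; omega
    · simp
  · intro v hv
    have h := ((mem_Top.1 hv) c).1 hc
    obtain ⟨⟨k, hk⟩, h2, h3⟩ := h
    split_ifs with h0 h1 h1
    · rw [neg_neg']
    · simp [neg] at h1; omega
    · simp at h1; omega
    · simp
  · intro v hv
    have h := ((mem_Top.1 hv) c).1 hc
    obtain ⟨hodd, h2, h3⟩ := h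
    split_ifs with h0
    · have := hG c.1 (Function.update v c (v c + 1)) (cube_update (Top_cube hv) hodd (Or.inl rfl))
        ⟨c.2, by rw [Prod.mk.eta, Function.update_self, h0]; exact abs_of_nonneg (by omega)⟩
      simp only [Finset.notMem_empty, if_false, add_zero] at this
      rw [← this, neg_update]
      simp only [neg, if_true]
      congr 2; ring
    · simp only [Function.update_self, Function.update_idem]
      congr 2; ring

lemma stokes {n : ℕ} {b : Fin 4 →₀ ℕ} {G : (Fin 4 × Fin d → ℤ) → ZMod 2}
    (hG : Equi n ∅ G) : ∑ v ∈ Top n b, cob G v = 0 := by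
  simp only [cob]
  rw [Finset.sum_comm]
  refine Finset.sum_eq_zero fun c _ => ?_
  by_cases hc : (c.2 : ℕ) < b c.1
  · rw [Finset.sum_congr rfl (g := fun v => G (Function.update v c (v c + 1)) +
      G (Function.update v c (v c - 1)))]
    · rw [Finset.sum_add_distrib, stokes_one hG c hc, z2]
    · intro v hv
      rw [if_pos (((mem_Top.1 hv) c).1 hc).1]
  · refine Finset.sum_eq_zero fun v hv => ?_
    rw [((mem_Top.1 hv) c).2 hc]; simp

open Classical in
/-- standard section: sign of the last nonzero coordinate -/
noncomputable def std (i : Fin 4) (v : Fin 4 × Fin d → ℤ) : ZMod 2 :=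
  if ∃ k, v (i, k) < 0 ∧ ∀ k', k < k' → v (i, k') = 0 then 1 else 0

lemma std_eq {i : Fin 4} {v : Fin 4 × Fin d → ℤ} {k} (h0 : v (i, k) ≠ 0)
    (h : ∀ k', k < k' → v (i, k') = 0) : std i v = if v (i, k) < 0 then 1 else 0 := by
  simp only [std]
  congr 1
  rw [eq_iff_iff]
  constructor
  · rintro ⟨k', h1, h2⟩
    rcases lt_trichotomy k k' with hk | hk | hk
    · rw [h _ hk] at h1; omega
    · rwa [hk]
    · exact absurd (h2 _ hk) h0
  · intro h1; exact ⟨k, h1, h⟩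

lemma std_congr {i : Fin 4} {v w : Fin 4 × Fin d → ℤ} (h : ∀ k, v (i, k) = w (i, k)) :
    std i v = std i w := by
  simp only [std, h]

lemma std_equi {n : ℤ} (hn : 0 < n) (i : Fin 4) : Equi n {i} (std (d := d) i) := by
  intro i' v _ hb
  by_cases h : i' = i
  · subst h
    simp only [Finset.mem_singleton, if_true]
    obtain ⟨k0, hk0⟩ := hb
    have hne : v (i', k0) ≠ 0 := by intro e; rw [e] at hk0; simp at hk0; omega
    let S := Finset.univ.filter fun k => v (i', k) ≠ 0
    have hS : S.Nonempty := ⟨k0, by simp [S, hne]⟩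
    have hm := S.max'_mem hS
    have h0 : v (i', S.max' hS) ≠ 0 := by simpa [S] using hm
    have hl : ∀ k', S.max' hS < k' → v (i', k') = 0 := by
      intro k' hk'
      by_contra hcon
      exact absurd (S.le_max' k' (by simp [S, hcon])) (not_le.2 hk')
    rw [std_eq h0 hl, std_eq (k := S.max' hS) (by simpa [neg] using h0)
      (by intro k' hk'; simp [neg, hl k' hk'])]
    simp only [neg, if_true]
    rcases lt_or_gt_of_ne h0 with hh | hh
    · rw [if_neg (by omega), if_pos hh, z2]
    · rw [if_pos (by omega), if_neg (by omega), zero_add]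
  · simp only [Finset.mem_singleton, h, if_false, add_zero]
    refine std_congr fun k => ?_
    simp [neg, Ne.symm h]


lemma std_update {n : ℕ} {b : Fin 4 →₀ ℕ} (i : Fin 4) (hb : b i ≤ d)
    {v : Fin 4 × Fin d → ℤ} (hv : v ∈ Top n b) {c : Fin 4 × Fin d} (ho : Odd (v c))
    (hc : ¬ (c.1 = i ∧ (c.2 : ℕ) + 1 = b i)) (x : ℤ) :
    std i (Function.update v c x) = std i v := by
  have hv' := mem_Top.1 hv
  by_cases h : c.1 = i
  · have hlt : (c.2 : ℕ) < b c.1 := by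
      by_contra hcon
      rw [(hv' c).2 hcon] at ho
      simp at ho
    rw [h] at hlt
    have hne : ¬ (c.2 : ℕ) + 1 = b i := fun e => hc ⟨h, e⟩
    let l : Fin d := ⟨b i - 1, by omega⟩
    have hl : ∀ k', l < k' → v (i, k') = 0 := by
      intro k' hk'
      apply (hv' (i, k')).2
      have : b i - 1 < (k' : ℕ) := hk'
      simp only; omega
    have h0 : v (i, l) ≠ 0 := by
      have := ((hv' (i, l)).1 (by simp only [l]; omega)).1
      intro e; rw [e] at this; simp at this
    have hcl : ∀ k', l ≤ k' → (i, k') ≠ c := by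
      intro k' hk' e
      have : b i - 1 ≤ (k' : ℕ) := hk'
      rw [← e] at hlt hne
      simp only at hlt hne; omega
    rw [std_eq h0 hl, std_eq (k := l)]
    · rw [Function.update_of_ne (hcl l le_rfl)]
    · rw [Function.update_of_ne (hcl l le_rfl)]; exact h0
    · intro k' hk'
      rw [Function.update_of_ne (hcl k' hk'.le)]; exact hl k' hk'
  · refine std_congr fun k => ?_
    rw [Function.update_of_ne]
    rintro rfl
    exact h rfl

lemma sub_single_lt {b : Fin 4 →₀ ℕ} {i : Fin 4} (h0 : b i ≠ 0) (c : Fin 4 × Fin d)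
    (hc : ¬ (c.1 = i ∧ (c.2 : ℕ) + 1 = b i)) :
    ((c.2 : ℕ) < (b - Finsupp.single i 1 : Fin 4 →₀ ℕ) c.1 ↔ (c.2 : ℕ) < b c.1) := by
  by_cases h : c.1 = i
  · have : ¬ (c.2 : ℕ) + 1 = b i := fun e => hc ⟨h, e⟩
    simp [h]; omega
  · simp [Finsupp.single_apply, Ne.symm h]

lemma std_top {n : ℕ} {b : Fin 4 →₀ ℕ} (i : Fin 4) {l : Fin d} (hl : (l : ℕ) + 1 = b i)
    {v : Fin 4 × Fin d → ℤ} (hv : v ∈ Top n b) {x : ℤ} (hx : x ≠ 0) :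
    std i (Function.update v (i, l) x) = if x < 0 then 1 else 0 := by
  rw [std_eq (k := l)]
  · simp
  · simpa using hx
  · intro k' hk'
    have : (i, k') ≠ (i, l) := by
      intro e; simp only [Prod.mk.injEq, true_and] at e; exact absurd e hk'.ne'
    rw [Function.update_of_ne this]
    apply ((mem_Top.1 hv) _).2
    have : (l : ℕ) < k' := hk'
    simp only; omega

lemma std_sum_aux {n : ℕ} (hn : 0 < n) {b : Fin 4 →₀ ℕ} (i : Fin 4) {l : Fin d}
    (hl : (l : ℕ) + 1 = b i) (G : (Fin 4 × Fin d → ℤ) → ZMod 2) {x : ℤ} (hx : x = 1 ∨ x = -1) :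
    ∑ v ∈ Top n b, (if v (i, l) = x then G (Function.update v (i, l) 0) else 0) =
      ∑ w ∈ Top n (b - Finsupp.single i 1), G w := by
  rw [← Finset.sum_filter]
  have h0 : b i ≠ 0 := by omega
  have hcl : ∀ c : Fin 4 × Fin d, c ≠ (i, l) → ¬ (c.1 = i ∧ (c.2 : ℕ) + 1 = b i) := by
    rintro ⟨c1, c2⟩ hc ⟨h1, h2⟩
    simp only at h1 h2
    apply hc
    rw [Prod.mk.injEq]; exact ⟨h1, by ext; omega⟩
  have hll : ¬ ((l : ℕ) < (b - Finsupp.single i 1 : Fin 4 →₀ ℕ) i) := by simp; omega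
  refine Finset.sum_nbij' (fun v => Function.update v (i, l) 0)
    (fun w => Function.update w (i, l) x) ?_ ?_ ?_ ?_ ?_
  · intro v hv
    rw [Finset.mem_filter] at hv
    have hv1 := mem_Top.1 hv.1
    rw [mem_Top]
    intro c
    by_cases e : c = (i, l)
    · subst e; simp only [Function.update_self]
      exact ⟨fun h => absurd h hll, fun _ => by trivial⟩
    · rw [Function.update_of_ne e, sub_single_lt h0 c (hcl c e)]; exact hv1 c
  · intro w hw
    rw [Finset.mem_filter]
    refine ⟨?_, by simp⟩
    rw [mem_Top] at hw ⊢
    intro c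
    by_cases e : c = (i, l)
    · subst e; simp only [Function.update_self]
      refine ⟨fun _ => ?_, fun h => absurd (by omega) h⟩
      rcases hx with rfl | rfl
      · exact ⟨odd_one, by omega, by omega⟩
      · exact ⟨odd_one.neg, by omega, by omega⟩
    · rw [Function.update_of_ne e, ← sub_single_lt h0 c (hcl c e)]; exact hw c
  · intro v hv
    rw [Finset.mem_filter] at hv
    simp [← hv.2]
  · intro w hw
    have : w (i, l) = 0 := ((mem_Top.1 hw) (i, l)).2 hll
    simp [← this]
  · intro v _; rfl

lemma std_sum {n : ℕ} (hn : 0 < n) {b : Fin 4 →₀ ℕ} (i : Fin 4) (hb : b i ≤ d)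
    (F : (Fin 4 × Fin d → ℤ) → ZMod 2) (hF : cob F = 0) :
    ∑ v ∈ Top n b, cob (std i * F) v =
      if b i = 0 then 0 else ∑ w ∈ Top n (b - Finsupp.single i 1), F w := by
  simp only [cob_mul_eq _ _ hF]
  rw [Finset.sum_comm]
  have hz : ∀ c : Fin 4 × Fin d, ¬ (c.1 = i ∧ (c.2 : ℕ) + 1 = b i) →
      ∑ v ∈ Top n b, (if Odd (v c) then
      (std i (Function.update v c (v c + 1)) + std i v) * F (Function.update v c (v c + 1)) +
      (std i (Function.update v c (v c - 1)) + std i v) * F (Function.update v c (v c - 1)) else 0)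
      = 0 := by
    intro c hc
    refine Finset.sum_eq_zero fun v hv => ?_
    split_ifs with ho
    · rw [std_update i hb hv ho hc, std_update i hb hv ho hc, z2]; simp
    · rfl
  split_ifs with h0
  · refine Finset.sum_eq_zero fun c _ => hz c ?_
    omega
  · let l : Fin d := ⟨b i - 1, by omega⟩
    have hl : (l : ℕ) + 1 = b i := by simp only [l]; omega
    rw [Finset.sum_eq_single_of_mem (i, l) (Finset.mem_univ _)]
    · have e1 := std_sum_aux hn i hl (fun w => std i w * F w) (Or.inl rfl)
      have e2 := std_sum_aux hn i hl (fun w => (std i w + 1) * F w) (Or.inr rfl)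
      have e3 : ∑ w ∈ Top n (b - Finsupp.single i 1), F w =
          ∑ w ∈ Top n (b - Finsupp.single i 1), std i w * F w +
          ∑ w ∈ Top n (b - Finsupp.single i 1), (std i w + 1) * F w := by
        rw [← Finset.sum_add_distrib]
        refine Finset.sum_congr rfl fun w _ => ?_
        have := z2 (std i w)
        linear_combination (-F w) * this
      rw [e3, ← e1, ← e2, ← Finset.sum_add_distrib]
      refine Finset.sum_congr rfl fun v hv => ?_
      have ho : Odd (v (i, l)) := (((mem_Top.1 hv) (i, l)).1 (by simp only; omega)).1
      rw [if_pos ho]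
      have hne : v (i, l) ≠ 0 := by intro e; rw [e] at ho; simp at ho
      have hv0 : std i v = if v (i, l) < 0 then 1 else 0 := by
        have := std_top i hl hv hne
        rwa [Function.update_eq_self] at this
      rw [hv0]
      by_cases c1 : v (i, l) = 1
      · have hp := std_top i hl hv (x := v (i, l) + 1) (by omega)
        rw [hp]
        simp [c1]
      · by_cases c2 : v (i, l) = -1
        · have hp := std_top i hl hv (x := v (i, l) - 1) (by omega)
          rw [hp]
          simp [c2, z2]
        · have hp := std_top i hl hv (x := v (i, l) + 1) (by omega)
          have hm := std_top i hl hv (x := v (i, l) - 1) (by omega)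
          rw [hp, hm]
          by_cases hlt : v (i, l) < 0
          · rw [if_pos hlt, if_pos (by omega), if_pos (by omega)]
            simp [c1, c2, z2]
          · rw [if_neg hlt, if_neg (by omega), if_neg (by omega)]
            simp [c1, c2]
    · intro c _ hc
      apply hz
      rintro ⟨h1, h2⟩
      apply hc
      ext
      · simp [h1]
      · simp only; omega

/-- linear form -/
noncomputable def lin (I : Finset (Fin 4)) : MvPolynomial (Fin 4) (ZMod 2) :=
  ∑ i ∈ I, MvPolynomial.X i

lemma coeff_mul_lin (p : MvPolynomial (Fin 4) (ZMod 2)) (I : Finset (Fin 4)) (b : Fin 4 →₀ ℕ) :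
    MvPolynomial.coeff b (p * lin I) =
      ∑ i ∈ I, if b i = 0 then 0 else MvPolynomial.coeff (b - Finsupp.single i 1) p := by
  rw [lin, Finset.mul_sum, MvPolynomial.coeff_sum]
  refine Finset.sum_congr rfl fun i _ => ?_
  rw [MvPolynomial.coeff_mul_X']
  by_cases h : b i = 0 <;> simp [h]

lemma Equi.sum_std {n : ℤ} (hn : 0 < n) (I : Finset (Fin 4)) :
    Equi (d := d) n I (fun v => ∑ i ∈ I, std i v) := by
  intro i v hv hb
  simp only
  rw [Finset.sum_congr rfl fun j _ => std_equi hn j i v hv hb, Finset.sum_add_distrib]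
  simp

lemma main_count {n : ℕ} (hn : 0 < n) {χ : ℕ → Finset (Fin 4)}
    {s : ℕ → (Fin 4 × Fin d → ℤ) → ZMod 2} (hs : ∀ j, Equi n (χ j) (s j)) (N : ℕ) :
    ∀ (b : Fin 4 →₀ ℕ), (∀ i, b i ≤ d) → b.degree = N →
    ∑ v ∈ Top n b, Fs s N v = MvPolynomial.coeff b (∏ j ∈ Finset.range N, lin (χ j)) := by
  induction N with
  | zero =>
    intro b hb hN
    have : b = 0 := (Finsupp.degree_eq_zero_iff b).1 hN
    subst this
    have : Top n (0 : Fin 4 →₀ ℕ) = {(0 : Fin 4 × Fin d → ℤ)} := by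
      ext v
      rw [mem_Top]
      simp [funext_iff]
    rw [this]
    simp [Fs]
  | succ N ih =>
    intro b hb hN
    rw [Finset.prod_range_succ, coeff_mul_lin]
    let c : (Fin 4 × Fin d → ℤ) → ZMod 2 := fun v => s N v + ∑ i ∈ χ N, std i v
    have hc : Equi n ∅ (c * Fs s N) := by
      intro i v hv hbd
      have h1 := Fs_inv hs N i v hv hbd
      simp only [Finset.notMem_empty, if_false, add_zero] at h1 ⊢
      have h2 := hs N i v hv hbd
      have h3 := Equi.sum_std (by exact_mod_cast hn) (χ N) i v hv hbd
      simp only at h3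
      simp only [Pi.mul_apply, c, h1, h2, h3]
      have := z2 (if i ∈ χ N then 1 else 0)
      linear_combination (Fs s N v) * this
    have hd : s N * Fs s N = c * Fs s N + ∑ i ∈ χ N, (std i * Fs s N) := by
      funext v
      simp only [Pi.mul_apply, Pi.add_apply, c, Finset.sum_apply, ← Finset.sum_mul]
      have := z2 (∑ i ∈ χ N, std i v)
      linear_combination (-Fs s N v) * this
    have hcs : ∀ J : Finset (Fin 4), cob (∑ i ∈ J, (std i * Fs s N)) = ∑ i ∈ J, cob (std i * Fs s N) := by
      intro J
      induction J using Finset.induction_on with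
      | empty => funext v; simp [cob]
      | insert a J ha ihJ => rw [Finset.sum_insert ha, Finset.sum_insert ha, cob_add, ihJ]
    simp only [Fs]
    rw [hd, cob_add, hcs]
    simp only [Pi.add_apply, Finset.sum_apply]
    rw [Finset.sum_add_distrib, stokes hc, zero_add, Finset.sum_comm]
    refine Finset.sum_congr rfl fun i _ => ?_
    rw [std_sum hn i (hb i) _ (cob_Fs s N)]
    split_ifs with h0
    · rfl
    · apply ih
      · intro j; exact le_trans (by simp) (hb j)
      · have : b = (b - Finsupp.single i 1) + Finsupp.single i 1 := by
          ext j
          by_cases hj : i = j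
          · subst hj; simp; omega
          · simp [Finsupp.single_apply, hj]
        rw [this, map_add] at hN
        simpa using hN

lemma chain_exists {n : ℕ} {s : ℕ → (Fin 4 × Fin d → ℤ) → ZMod 2} (N : ℕ) :
    ∀ v, Cube n v → Fs s N v ≠ 0 → ∀ j < N, ∃ p p', Cube n p ∧ Cube n p' ∧
      (∀ c, |p c - v c| ≤ N) ∧ (∀ c, |p' c - v c| ≤ N) ∧ s j p ≠ s j p' := by
  induction N with
  | zero => intro v _ _ j hj; omega
  | succ N ih =>
    intro v hv hne j hj
    simp only [Fs] at hne
    rw [cob_mul_eq _ _ (cob_Fs s N)] at hne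
    obtain ⟨c, _, hc⟩ := Finset.exists_ne_zero_of_sum_ne_zero hne
    have ho : Odd (v c) := by
      by_contra h; rw [if_neg h] at hc; exact hc rfl
    rw [if_pos ho] at hc
    have : ∃ x, (x = v c + 1 ∨ x = v c - 1) ∧
        (s N (Function.update v c x) + s N v) * Fs s N (Function.update v c x) ≠ 0 := by
      by_contra hcon
      push Not at hcon
      rw [hcon _ (Or.inl rfl), hcon _ (Or.inr rfl)] at hc
      simp at hc
    obtain ⟨x, hx, hxx⟩ := this
    have hu := cube_update hv ho hx
    have hd : ∀ c', |Function.update v c x c' - v c'| ≤ 1 := by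
      intro c'
      by_cases e : c' = c
      · subst e; rw [Function.update_self, abs_le]; omega
      · rw [Function.update_of_ne e]; simp
    rcases Nat.lt_succ_iff_lt_or_eq.1 hj with hj' | rfl
    · obtain ⟨p, p', h1, h2, h3, h4, h5⟩ := ih _ hu (right_ne_zero_of_mul hxx) j hj'
      refine ⟨p, p', h1, h2, fun c' => ?_, fun c' => ?_, h5⟩
      · have := h3 c'; have := hd c'; rw [abs_le] at *; push_cast; omega
      · have := h4 c'; have := hd c'; rw [abs_le] at *; push_cast; omega
    · refine ⟨_, v, hu, hv, fun c' => ?_, fun c' => ?_, ?_⟩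
      · refine (hd c').trans ?_; push_cast; omega
      · simp; omega
      · intro e
        rw [e, z2, zero_mul] at hxx
        exact hxx rfl


/-- real version of block negation -/
def negR (i : Fin 4) (x : Fin 4 × Fin d → ℝ) : Fin 4 × Fin d → ℝ :=
  fun c => if c.1 = i then - x c else x c

/-- scale a grid point into the unit cube -/
noncomputable def scl (n : ℕ) (v : Fin 4 × Fin d → ℤ) : Fin 4 × Fin d → ℝ :=
  fun c => (v c : ℝ) / (2 * n)

lemma scl_neg (n : ℕ) (i : Fin 4) (v : Fin 4 × Fin d → ℤ) : scl n (neg i v) = negR i (scl n v) := by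
  funext c
  simp only [scl, neg, negR]
  split_ifs
  · push_cast; ring
  · rfl

lemma scl_cube {n : ℕ} (hn : 0 < n) {v : Fin 4 × Fin d → ℤ} (hv : Cube n v) (c) :
    |scl n v c| ≤ 1 := by
  have hn' : (0 : ℝ) < 2 * n := by positivity
  simp only [scl]
  rw [abs_div, abs_of_pos hn', div_le_one hn']
  have := hv c
  exact_mod_cast this

lemma scl_bd {n : ℕ} (hn : 0 < n) {v : Fin 4 × Fin d → ℤ} {i} (hv : Bd n i v) :
    ∃ k, |scl n v (i, k)| = 1 := by
  have hn' : (0 : ℝ) < 2 * n := by positivity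
  obtain ⟨k, hk⟩ := hv
  refine ⟨k, ?_⟩
  simp only [scl]
  rw [abs_div, abs_of_pos hn', div_eq_one_iff_eq hn'.ne']
  exact_mod_cast hk

lemma discrete_step {n : ℕ} (hn : 0 < n) (N : ℕ) (χ : ℕ → Finset (Fin 4))
    (g : ℕ → (Fin 4 × Fin d → ℝ) → ℝ)
    (heq : ∀ j i x, (∀ c, |x c| ≤ 1) → (∃ k, |x (i, k)| = 1) →
      g j (negR i x) = (if i ∈ χ j then -1 else 1) * g j x)
    (b : Fin 4 →₀ ℕ) (hb : ∀ i, b i ≤ d) (hN : b.degree = N)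
    (hco : MvPolynomial.coeff b (∏ j ∈ Finset.range N, lin (χ j)) ≠ 0) :
    ∃ v, Cube (d := d) n v ∧ ∀ j < N, ∃ p p', (∀ c, |p c - v c| ≤ N) ∧ (∀ c, |p' c - v c| ≤ N) ∧
      g j (scl n p) * g j (scl n p') ≤ 0 := by
  classical
  let s : ℕ → (Fin 4 × Fin d → ℤ) → ZMod 2 := fun j v =>
    if g j (scl n v) < 0 then 1 else if 0 < g j (scl n v) then 0 else ∑ i ∈ χ j, std i v
  have hs : ∀ j, Equi n (χ j) (s j) := by
    intro j i v hv hbd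
    have h1 := heq j i _ (scl_cube hn hv) (scl_bd hn hbd)
    have h2 := Equi.sum_std (by exact_mod_cast hn) (χ j) i v hv hbd
    simp only at h2
    simp only [s, scl_neg, h1, h2]
    by_cases hi : i ∈ χ j
    · simp only [hi, if_true]
      rcases lt_trichotomy (g j (scl n v)) 0 with h | h | h
      · rw [if_neg (by linarith), if_pos (by linarith), if_pos h, z2]
      · simp [h]
      · rw [if_pos (by linarith), if_neg (by linarith), if_pos h, zero_add]
    · simp only [hi, if_false, one_mul, add_zero]
  have hc := main_count hn hs N b hb hN
  rw [← hc] at hco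
  obtain ⟨v, hv, hv0⟩ := Finset.exists_ne_zero_of_sum_ne_zero hco
  refine ⟨v, Top_cube hv, fun j hj => ?_⟩
  obtain ⟨p, p', -, -, h3, h4, h5⟩ := chain_exists N v (Top_cube hv) hv0 j hj
  refine ⟨p, p', h3, h4, ?_⟩
  by_contra hcon
  push Not at hcon
  apply h5
  simp only [s]
  rcases pos_and_pos_or_neg_and_neg_of_mul_pos hcon with ⟨ha, hb⟩ | ⟨ha, hb⟩
  · rw [if_neg (by linarith), if_pos ha, if_neg (by linarith), if_pos hb]
  · rw [if_pos ha, if_pos hb]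

lemma scl_close {n : ℕ} (hn : 0 < n) {N : ℕ} {v p : Fin 4 × Fin d → ℤ}
    (h : ∀ c, |p c - v c| ≤ N) (c) : |scl n p c - scl n v c| ≤ N / (2 * n) := by
  have hn' : (0 : ℝ) < 2 * n := by positivity
  simp only [scl]
  rw [← sub_div, abs_div, abs_of_pos hn']
  gcongr
  exact_mod_cast h c

open Filter Topology in
theorem zero_exists_nat (N : ℕ) (χ : ℕ → Finset (Fin 4))
    (g : ℕ → (Fin 4 × Fin d → ℝ) → ℝ) (hg : ∀ j, Continuous (g j))
    (heq : ∀ j i x, (∀ c, |x c| ≤ 1) → (∃ k, |x (i, k)| = 1) →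
      g j (negR i x) = (if i ∈ χ j then -1 else 1) * g j x)
    (b : Fin 4 →₀ ℕ) (hb : ∀ i, b i ≤ d) (hN : b.degree = N)
    (hco : MvPolynomial.coeff b (∏ j ∈ Finset.range N, lin (χ j)) ≠ 0) :
    ∃ x : Fin 4 × Fin d → ℝ, (∀ c, |x c| ≤ 1) ∧ ∀ j < N, g j x = 0 := by
  choose v hv hp using fun n : ℕ => discrete_step (Nat.succ_pos n) N χ g heq b hb hN hco
  have hK : IsCompact (Set.pi Set.univ fun _ : Fin 4 × Fin d => Set.Icc (-1 : ℝ) 1) :=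
    isCompact_univ_pi fun _ => isCompact_Icc
  have hmem : ∀ n, scl (n + 1) (v n) ∈ (Set.pi Set.univ fun _ : Fin 4 × Fin d => Set.Icc (-1 : ℝ) 1) := by
    intro n c _
    have := scl_cube (Nat.succ_pos n) (hv n) c
    exact abs_le.1 this
  obtain ⟨x, hx, φ, hφ, hlim⟩ := hK.tendsto_subseq hmem
  refine ⟨x, fun c => abs_le.2 (hx c trivial), fun j hj => ?_⟩
  choose p p' h1 h2 h3 using fun n => hp n j hj
  have hsmall : Tendsto (fun n : ℕ => (N : ℝ) / (2 * ((φ n + 1 : ℕ) : ℝ))) atTop (𝓝 0) := by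
    have h0 : Tendsto (fun n : ℕ => (N : ℝ) / (2 * ((n + 1 : ℕ) : ℝ))) atTop (𝓝 0) := by
      apply Tendsto.div_atTop tendsto_const_nhds
      apply Tendsto.const_mul_atTop (by norm_num)
      exact tendsto_natCast_atTop_atTop.comp (tendsto_add_atTop_nat 1)
    exact h0.comp hφ.tendsto_atTop
  have hconv : ∀ r : ℕ → (Fin 4 × Fin d → ℤ), (∀ n c, |r n c - v n c| ≤ N) →
      Tendsto (fun n => scl (φ n + 1) (r (φ n))) atTop (𝓝 x) := by
    intro r hr
    rw [tendsto_pi_nhds] at hlim ⊢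
    intro c
    have hd : Tendsto (fun n => scl (φ n + 1) (r (φ n)) c - scl (φ n + 1) (v (φ n)) c) atTop (𝓝 0) := by
      apply squeeze_zero_norm _ hsmall
      intro n
      rw [Real.norm_eq_abs]
      exact scl_close (Nat.succ_pos _) (hr (φ n)) c
    have := hd.add (hlim c)
    simpa using this
  have l1 := ((hg j).tendsto x).comp (hconv p h1)
  have l2 := ((hg j).tendsto x).comp (hconv p' h2)
  have l3 := le_of_tendsto (l1.mul l2) (Eventually.of_forall fun n => h3 (φ n))
  nlinarith [mul_self_nonneg (g j x), mul_self_eq_zero.1 (le_antisymm l3 (mul_self_nonneg (g j x)))]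

lemma lin_hom (I : Finset (Fin 4)) : (lin I).IsHomogeneous 1 :=
  MvPolynomial.IsHomogeneous.sum _ _ _ fun i _ => MvPolynomial.isHomogeneous_X _ i

theorem zero_exists {J : Type*} [Fintype J] (χ : J → Finset (Fin 4))
    (g : J → (Fin 4 × Fin d → ℝ) → ℝ) (hg : ∀ j, Continuous (g j))
    (heq : ∀ j i x, (∀ c, |x c| ≤ 1) → (∃ k, |x (i, k)| = 1) →
      g j (negR i x) = (if i ∈ χ j then -1 else 1) * g j x)
    (b : Fin 4 →₀ ℕ) (hb : ∀ i, b i ≤ d)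
    (hco : MvPolynomial.coeff b (∏ j, lin (χ j)) ≠ 0) :
    ∃ x : Fin 4 × Fin d → ℝ, (∀ c, |x c| ≤ 1) ∧ ∀ j, g j x = 0 := by
  classical
  let e := Fintype.equivFin J
  let χ' : ℕ → Finset (Fin 4) := fun j =>
    if h : j < Fintype.card J then χ (e.symm ⟨j, h⟩) else ∅
  let g' : ℕ → (Fin 4 × Fin d → ℝ) → ℝ := fun j =>
    if h : j < Fintype.card J then g (e.symm ⟨j, h⟩) else fun _ => 1
  have hprod : ∏ j ∈ Finset.range (Fintype.card J), lin (χ' j) = ∏ j, lin (χ j) := by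
    rw [Finset.prod_range, ← Equiv.prod_comp e.symm (fun j => lin (χ j))]
    refine Finset.prod_congr rfl fun i _ => ?_
    simp [χ']
  have hdeg : b.degree = Fintype.card J := by
    have hh : (∏ j, lin (χ j)).IsHomogeneous (∑ _j : J, 1) :=
      MvPolynomial.IsHomogeneous.prod _ _ _ fun j _ => lin_hom _
    by_contra hcon
    exact hco (hh.coeff_eq_zero (by simpa using hcon))
  obtain ⟨x, hx, h0⟩ := zero_exists_nat (d := d) (Fintype.card J) χ' g' (by
      intro j
      simp only [g']
      split_ifs
      · exact hg _
      · exact continuous_const) (by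
      intro j i x hx hk
      simp only [g', χ']
      split_ifs with h1 h2 h2
      · rw [heq _ i x hx hk, if_pos h2]
      · rw [heq _ i x hx hk, if_neg h2]
      · simp at h2
      · simp) b hb hdeg (by rw [hprod]; exact hco)
  refine ⟨x, hx, fun j => ?_⟩
  have := h0 (e j) (e j).2
  simpa [g'] using this

end blocks


section algebra
open MvPolynomial

/-- exponent vector -/
noncomputable def ev (a b c d : ℕ) : Fin 4 →₀ ℕ := Finsupp.equivFunOnFinite.symm ![a, b, c, d]

lemma ev_ext {n : Fin 4 →₀ ℕ} {a b c d : ℕ} (h0 : n 0 = a) (h1 : n 1 = b) (h2 : n 2 = c)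
    (h3 : n 3 = d) : n = ev a b c d := by
  ext i; fin_cases i <;> simp [ev, h0, h1, h2, h3]

/-- computable coefficient -/
def cf : List (Bool × Bool × Bool × Bool) → (ℕ → ℕ → ℕ → ℕ → Bool) → ℕ → ℕ → ℕ → ℕ → Bool
  | [], base, a, b, c, d => base a b c d
  | (p, q, r, s) :: w, base, a, b, c, d =>
    xor (xor (p && (match a with | 0 => false | a + 1 => cf w base a b c d))
      (q && (match b with | 0 => false | b + 1 => cf w base a b c d)))
     (xor (r && (match c with | 0 => false | c + 1 => cf w base a b c d))
      (s && (match d with | 0 => false | d + 1 => cf w base a b c d)))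

noncomputable def linB (t : Bool × Bool × Bool × Bool) : MvPolynomial (Fin 4) (ZMod 2) :=
  (if t.1 then X 0 else 0) + (if t.2.1 then X 1 else 0) +
    ((if t.2.2.1 then X 2 else 0) + (if t.2.2.2 then X 3 else 0))

def bz (x : Bool) : ZMod 2 := if x then 1 else 0

lemma bz_xor (x y : Bool) : bz (xor x y) = bz x + bz y := by
  cases x <;> cases y <;> decide

lemma bz_and (x y : Bool) : bz (x && y) = if x then bz y else 0 := by
  cases x <;> cases y <;> decide

lemma coeff_X0 (p : MvPolynomial (Fin 4) (ZMod 2)) (a b c d : ℕ) :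
    coeff (ev a b c d) (p * X 0) = match a with | 0 => 0 | a + 1 => coeff (ev a b c d) p := by
  rw [coeff_mul_X']
  cases a with
  | zero => simp [ev]
  | succ a =>
    simp only [Finsupp.mem_support_iff]
    rw [if_pos (by simp [ev])]
    congr 1
    apply ev_ext <;> simp [ev]

lemma coeff_X1 (p : MvPolynomial (Fin 4) (ZMod 2)) (a b c d : ℕ) :
    coeff (ev a b c d) (p * X 1) = match b with | 0 => 0 | b + 1 => coeff (ev a b c d) p := by
  rw [coeff_mul_X']
  cases b with
  | zero => simp [ev]
  | succ a =>
    simp only [Finsupp.mem_support_iff]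
    rw [if_pos (by simp [ev])]
    congr 1
    apply ev_ext <;> simp [ev]

lemma coeff_X2 (p : MvPolynomial (Fin 4) (ZMod 2)) (a b c d : ℕ) :
    coeff (ev a b c d) (p * X 2) = match c with | 0 => 0 | c + 1 => coeff (ev a b c d) p := by
  rw [coeff_mul_X']
  cases c with
  | zero => simp [ev]
  | succ a =>
    simp only [Finsupp.mem_support_iff]
    rw [if_pos (by simp [ev])]
    congr 1
    apply ev_ext <;> simp [ev]

lemma coeff_X3 (p : MvPolynomial (Fin 4) (ZMod 2)) (a b c d : ℕ) :
    coeff (ev a b c d) (p * X 3) = match d with | 0 => 0 | d + 1 => coeff (ev a b c d) p := by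
  rw [coeff_mul_X']
  cases d with
  | zero => simp [ev]
  | succ a =>
    simp only [Finsupp.mem_support_iff]
    rw [if_pos (by simp [ev])]
    congr 1
    apply ev_ext <;> simp [ev]

lemma cf_spec (p : MvPolynomial (Fin 4) (ZMod 2)) (base : ℕ → ℕ → ℕ → ℕ → Bool)
    (hp : ∀ a b c d, coeff (ev a b c d) p = bz (base a b c d))
    (w : List (Bool × Bool × Bool × Bool)) :
    ∀ a b c d, coeff (ev a b c d) (p * (w.map linB).prod) = bz (cf w base a b c d) := by
  induction w with
  | nil => intro a b c d; simpa [cf] using hp a b c d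
  | cons t w ih =>
    intro a b c d
    obtain ⟨t0, t1, t2, t3⟩ := t
    have e : p * (List.map linB ((t0, t1, t2, t3) :: w)).prod =
        (p * (List.map linB w).prod) * linB (t0, t1, t2, t3) := by
      simp only [List.map_cons, List.prod_cons]; ring
    rw [e, linB, mul_add, mul_add, mul_add]
    simp only [coeff_add, cf, bz_xor, bz_and]
    congr 1
    · congr 1
      · cases t0
        · simp
        · simp only [if_true, coeff_X0]
          cases a
          · rfl
          · exact ih _ _ _ _
      · cases t1
        · simp
        · simp only [if_true, coeff_X1]
          cases b
          · rfl
          · exact ih _ _ _ _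
    · congr 1
      · cases t2
        · simp
        · simp only [if_true, coeff_X2]
          cases c
          · rfl
          · exact ih _ _ _ _
      · cases t3
        · simp
        · simp only [if_true, coeff_X3]
          cases d
          · rfl
          · exact ih _ _ _ _

def wB : List (Bool × Bool × Bool × Bool) :=
  [(true, true, false, false), (false, true, true, false), (false, false, true, true),
    (true, true, true, false)]

def wZ : List (Bool × Bool × Bool × Bool) :=
  [(true, false, true, false), (true, false, false, true), (false, true, false, true),
    (true, true, false, true), (true, false, true, true), (false, true, true, true)]

noncomputable def pB : MvPolynomial (Fin 4) (ZMod 2) := (wB.map linB).prod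
noncomputable def pZ : MvPolynomial (Fin 4) (ZMod 2) := (wZ.map linB).prod

def base0 (a b c d : ℕ) : Bool := a.beq 0 && (b.beq 0 && (c.beq 0 && d.beq 0))

def baseZ (a b c d : ℕ) : Bool :=
  ((a % 2).beq 0 && ((b % 2).beq 0 && ((c % 2).beq 0 && (d % 2).beq 0))) &&
    cf wZ base0 (a / 2) (b / 2) (c / 2) (d / 2)

lemma base0_spec (a b c d : ℕ) :
    coeff (ev a b c d) (1 : MvPolynomial (Fin 4) (ZMod 2)) = bz (base0 a b c d) := by
  rw [coeff_one]
  have : (0 = ev a b c d) ↔ base0 a b c d = true := by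
    simp only [base0, Bool.and_eq_true, Nat.beq_eq]
    constructor
    · intro h
      have h' := fun i => (DFunLike.congr_fun h i).symm
      exact ⟨by simpa [ev] using h' 0, by simpa [ev] using h' 1, by simpa [ev] using h' 2,
        by simpa [ev] using h' 3⟩
    · rintro ⟨h0, h1, h2, h3⟩
      exact ev_ext (by simp [h0]) (by simp [h1]) (by simp [h2]) (by simp [h3])
  simp only [this, bz]

lemma sq_expand (p : MvPolynomial (Fin 4) (ZMod 2)) : p ^ 2 = expand 2 p :=
  (expand_zmod p).symm

lemma coeff_sq_two (p : MvPolynomial (Fin 4) (ZMod 2)) (n : Fin 4 →₀ ℕ) :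
    coeff (2 • n) (p ^ 2) = coeff n p := by
  rw [sq_expand, coeff_expand_smul _ two_ne_zero]

lemma coeff_sq_odd (p : MvPolynomial (Fin 4) (ZMod 2)) (n : Fin 4 →₀ ℕ) (i : Fin 4)
    (h : ¬ 2 ∣ n i) : coeff n (p ^ 2) = 0 := by
  rw [sq_expand, coeff_expand_of_not_dvd _ h]

lemma pZ_sq (a b c d : ℕ) : coeff (ev a b c d) (pZ ^ 2) = bz (baseZ a b c d) := by
  have hZ := cf_spec 1 base0 base0_spec wZ
  simp only [one_mul] at hZ
  by_cases h : a % 2 = 0 ∧ b % 2 = 0 ∧ c % 2 = 0 ∧ d % 2 = 0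
  · obtain ⟨h0, h1, h2, h3⟩ := h
    have : ev a b c d = 2 • ev (a / 2) (b / 2) (c / 2) (d / 2) := by
      symm
      apply ev_ext <;> simp [ev] <;> omega
    rw [this, coeff_sq_two, pZ, hZ]
    simp [baseZ, h0, h1, h2, h3]
  · have hb : baseZ a b c d = false := by
      simp only [baseZ, Bool.and_eq_false_iff]
      left
      by_contra hcon
      apply h
      simpa using hcon
    rw [hb]
    have : ∃ i, ¬ 2 ∣ ev a b c d i := by
      by_contra hcon
      push Not at hcon
      apply h
      have h0 := hcon 0
      have h1 := hcon 1
      have h2 := hcon 2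
      have h3 := hcon 3
      simp [ev] at h0 h1 h2 h3
      omega
    obtain ⟨i, hi⟩ := this
    rw [coeff_sq_odd _ _ i hi]; rfl

lemma coeff_pB : coeff (ev 1 1 1 1) pB = 1 := by
  have hB := cf_spec 1 base0 base0_spec wB 1 1 1 1
  rw [one_mul] at hB
  rw [pB, hB]
  decide

lemma coeff_BZ : coeff (ev 4 4 4 4) (pB * pZ ^ 2) = 1 := by
  have h := cf_spec (pZ ^ 2) baseZ pZ_sq wB 4 4 4 4
  rw [mul_comm, pB, h]
  have : cf wB baseZ 4 4 4 4 = true := by decide +kernel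
  rw [this]; rfl

lemma linB_hom (t) : (linB t).IsHomogeneous 1 := by
  unfold linB
  refine IsHomogeneous.add (IsHomogeneous.add ?_ ?_) (IsHomogeneous.add ?_ ?_) <;> split_ifs <;>
    first | exact isHomogeneous_X _ _ | exact isHomogeneous_zero _ _ _

lemma pB_hom : pB.IsHomogeneous 4 := by
  have : pB = linB (true, true, false, false) * linB (false, true, true, false) *
    linB (false, false, true, true) * linB (true, true, true, false) := by
    simp [pB, wB]; ring
  rw [this]
  exact (((linB_hom _).mul (linB_hom _)).mul (linB_hom _)).mul (linB_hom _)

lemma coeff_B_sq (G : MvPolynomial (Fin 4) (ZMod 2)) (k : ℕ) :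
    coeff (ev (2 * k + 1) (2 * k + 1) (2 * k + 1) (2 * k + 1)) (pB * G ^ 2) =
      coeff (ev k k k k) G := by
  rw [coeff_mul, Finset.sum_eq_single_of_mem (ev 1 1 1 1, 2 • ev k k k k)]
  · rw [coeff_pB, coeff_sq_two, one_mul]
  · rw [Finset.HasAntidiagonal.mem_antidiagonal]
    apply ev_ext <;> simp [ev] <;> omega
  · rintro ⟨x, y⟩ hxy hne
    rw [Finset.HasAntidiagonal.mem_antidiagonal] at hxy
    simp only at hxy ⊢
    by_cases hy : ∃ i, ¬ 2 ∣ y i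
    · obtain ⟨i, hi⟩ := hy
      rw [coeff_sq_odd _ _ i hi, mul_zero]
    · push Not at hy
      by_cases hd : x.degree = 4
      · exfalso
        apply hne
        have hs : x 0 + x 1 + x 2 + x 3 = 4 := by
          have h4 := hd
          rw [Finsupp.degree_eq_sum, Fin.sum_univ_four] at h4
          exact h4
        have e : ∀ i, x i + y i = 2 * k + 1 := by
          intro i
          have := DFunLike.congr_fun hxy i
          rw [Finsupp.add_apply] at this
          rw [this]
          fin_cases i <;> simp [ev]
        have e0 := e 0; have e1 := e 1; have e2 := e 2; have e3 := e 3
        have y0 := hy 0; have y1 := hy 1; have y2 := hy 2; have y3 := hy 3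
        have hx : x = ev 1 1 1 1 := by
          apply ev_ext <;> omega
        have hyy : y = 2 • ev k k k k := by
          have hx0 : x 0 = 1 := by omega
          have hx1 : x 1 = 1 := by omega
          have hx2 : x 2 = 1 := by omega
          have hx3 : x 3 = 1 := by omega
          ext i; fin_cases i <;> simp [ev] <;> omega
        rw [hx, hyy]
      · rw [pB_hom.coeff_eq_zero hd, zero_mul]

lemma coeff_main (q : ℕ) : ∀ s < 2 ^ q,
    coeff (ev (4 * 2 ^ q + s) (4 * 2 ^ q + s) (4 * 2 ^ q + s) (4 * 2 ^ q + s))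
      (pB ^ (2 ^ q + s) * pZ ^ (2 * 2 ^ q)) = 1 := by
  induction q with
  | zero =>
    intro s hs
    have : s = 0 := by simpa using hs
    subst this
    simpa using coeff_BZ
  | succ q ih =>
    intro s hs
    have hq : (2 : ℕ) ^ (q + 1) = 2 * 2 ^ q := by ring
    rw [hq] at hs ⊢
    rcases Nat.even_or_odd' s with ⟨r, rfl | rfl⟩
    · have e1 : pB ^ (2 * 2 ^ q + 2 * r) * pZ ^ (2 * (2 * 2 ^ q)) =
          (pB ^ (2 ^ q + r) * pZ ^ (2 * 2 ^ q)) ^ 2 := by ring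
      have e2 : ∀ k, ev (2 * k) (2 * k) (2 * k) (2 * k) = 2 • ev k k k k := by
        intro k; symm; apply ev_ext <;> simp [ev]
      rw [e1, show 4 * (2 * 2 ^ q) + 2 * r = 2 * (4 * 2 ^ q + r) by ring, e2, coeff_sq_two]
      exact ih r (by omega)
    · have e1 : pB ^ (2 * 2 ^ q + (2 * r + 1)) * pZ ^ (2 * (2 * 2 ^ q)) =
          pB * (pB ^ (2 ^ q + r) * pZ ^ (2 * 2 ^ q)) ^ 2 := by ring
      rw [e1, show 4 * (2 * 2 ^ q) + (2 * r + 1) = 2 * (4 * 2 ^ q + r) + 1 by ring, coeff_B_sq]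
      exact ih r (by omega)

/-- The product of the four variables. -/
noncomputable def pP : MvPolynomial (Fin 4) (ZMod 2) := X 0 * X 1 * X 2 * X 3

lemma pP_pow (k : ℕ) : pP ^ k = monomial (ev k k k k) 1 := by
  have : pP = monomial (ev 1 1 1 1) 1 := by
    simp only [pP, X, monomial_mul, one_mul]
    congr 2
    apply ev_ext <;> simp
  rw [this, monomial_pow, one_pow]
  congr 2
  apply ev_ext <;> simp [ev]

lemma exists_exponent (q t : ℕ) (ht1 : 1 ≤ t) (ht2 : t ≤ 2 ^ q) :
    ∃ b : Fin 4 →₀ ℕ, (∀ i, b i ≤ 7 * 2 ^ q - 2 * t) ∧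
      coeff b ((pP * pB * pZ) ^ (2 ^ (q + 1) - t)) ≠ 0 := by
  obtain ⟨s, hs⟩ : ∃ s, 2 ^ q = s + t := ⟨2 ^ q - t, by omega⟩
  have hm : 2 ^ (q + 1) - t = 2 ^ q + s := by rw [pow_succ]; omega
  have key : coeff (ev (7 * 2 ^ q) (7 * 2 ^ q) (7 * 2 ^ q) (7 * 2 ^ q))
      ((pP * pB * pZ) ^ (2 ^ q + s) * (pP ^ (2 * t) * pZ ^ t)) = 1 := by
    have e1 : (pP * pB * pZ) ^ (2 ^ q + s) * (pP ^ (2 * t) * pZ ^ t) =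
        (pB ^ (2 ^ q + s) * pZ ^ (2 * 2 ^ q)) * pP ^ (2 * 2 ^ q + t) := by
      have h1 : 2 * 2 ^ q = 2 ^ q + s + t := by omega
      have h2 : 2 * 2 ^ q + t = 2 ^ q + s + 2 * t := by omega
      rw [h2, h1]; ring
    rw [e1, pP_pow, show ev (7 * 2 ^ q) (7 * 2 ^ q) (7 * 2 ^ q) (7 * 2 ^ q) =
      ev (4 * 2 ^ q + s) (4 * 2 ^ q + s) (4 * 2 ^ q + s) (4 * 2 ^ q + s) +
      ev (2 * 2 ^ q + t) (2 * 2 ^ q + t) (2 * 2 ^ q + t) (2 * 2 ^ q + t) by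
        symm; apply ev_ext <;> simp [ev] <;> omega, coeff_mul_monomial, mul_one]
    exact coeff_main q s (by omega)
  rw [coeff_mul] at key
  obtain ⟨⟨x, y⟩, hxy, hne⟩ := Finset.exists_ne_zero_of_sum_ne_zero
    (by rw [key]; exact one_ne_zero)
  rw [Finset.HasAntidiagonal.mem_antidiagonal] at hxy
  simp only at hxy hne
  refine ⟨x, fun i => ?_, by rw [hm]; exact left_ne_zero_of_mul hne⟩
  have hy := right_ne_zero_of_mul hne
  rw [pP_pow, coeff_monomial_mul'] at hy
  have hle : ev (2 * t) (2 * t) (2 * t) (2 * t) ≤ y := by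
    by_contra hcon; rw [if_neg hcon] at hy; exact hy rfl
  have h1 := hle i
  have h2 := DFunLike.congr_fun hxy i
  rw [Finsupp.add_apply] at h2
  have h3 : ∀ k, ev k k k k i = k := by intro k; fin_cases i <;> simp [ev]
  rw [h3] at h1 h2
  omega

lemma prod_lin : ∏ I : {I : Finset (Fin 4) // 1 ≤ I.card ∧ I.card ≤ 3}, lin I.1 = pP * pB * pZ := by
  rw [← Finset.prod_subtype (Finset.univ.filter fun I : Finset (Fin 4) => 1 ≤ I.card ∧ I.card ≤ 3)
    (by simp) (fun I => lin I)]
  have : (Finset.univ.filter fun I : Finset (Fin 4) => 1 ≤ I.card ∧ I.card ≤ 3) =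
    {{0}, {1}, {2}, {3}, {0, 1}, {1, 2}, {2, 3}, {0, 1, 2}, {0, 2}, {0, 3}, {1, 3}, {0, 1, 3},
      {0, 2, 3}, {1, 2, 3}} := by decide
  rw [this]
  repeat rw [Finset.prod_insert (by decide)]
  rw [Finset.prod_singleton]
  have l2 : ∀ i j : Fin 4, i ≠ j → lin {i, j} = X i + X j := by
    intro i j h; rw [lin, Finset.sum_pair h]
  have l3 : ∀ i j k : Fin 4, i ≠ j → i ≠ k → j ≠ k → lin {i, j, k} = X i + (X j + X k) := by
    intro i j k h1 h2 h3
    rw [lin, Finset.sum_insert (by simp [h1, h2]), Finset.sum_pair h3]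
  have l1 : ∀ i : Fin 4, lin {i} = X i := by intro i; simp [lin]
  rw [l1, l1, l1, l1, l2 0 1 (by decide), l2 1 2 (by decide), l2 2 3 (by decide),
    l2 0 2 (by decide), l2 0 3 (by decide), l2 1 3 (by decide),
    l3 0 1 2 (by decide) (by decide) (by decide), l3 0 1 3 (by decide) (by decide) (by decide),
    l3 0 2 3 (by decide) (by decide) (by decide), l3 1 2 3 (by decide) (by decide) (by decide)]
  simp only [pP, pB, pZ, wB, wZ, linB, List.map_cons, List.map_nil, List.prod_cons, List.prod_nil,
    if_true, Bool.false_eq_true, if_false, add_zero, zero_add, mul_one]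
  generalize (X 0 : MvPolynomial (Fin 4) (ZMod 2)) = x0
  generalize (X 1 : MvPolynomial (Fin 4) (ZMod 2)) = x1
  generalize (X 2 : MvPolynomial (Fin 4) (ZMod 2)) = x2
  generalize (X 3 : MvPolynomial (Fin 4) (ZMod 2)) = x3
  simp only [← add_assoc, ← mul_assoc]

end algebra

section geom
open Finset

/-- flip a coordinate of a sign vector -/
def flip4 (k : Fin 4) (e : Fin 4 → Bool) : Fin 4 → Bool := fun i => if i = k then !(e i) else e i

def par (e : Fin 4 → Bool) : Bool := xor (xor (e 0) (e 1)) (xor (e 2) (e 3))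

noncomputable def sg (b : Bool) : ℝ := if b then -1 else 1

noncomputable def chi (I : Finset (Fin 4)) (e : Fin 4 → Bool) : ℝ := ∏ i ∈ I, sg (e i)

lemma flip4_flip4 (k : Fin 4) (e : Fin 4 → Bool) : flip4 k (flip4 k e) = e := by
  funext i
  by_cases h : i = k <;> simp [flip4, h]

lemma sg_not (b : Bool) : sg (!b) = - sg b := by cases b <;> simp [sg]

lemma chi_flip (I : Finset (Fin 4)) (k : Fin 4) (e : Fin 4 → Bool) :
    chi I (flip4 k e) = (if k ∈ I then -1 else 1) * chi I e := by
  unfold chi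
  split_ifs with h
  · rw [← Finset.mul_prod_erase _ _ h, ← Finset.mul_prod_erase I (fun i => sg (e i)) h]
    have : ∏ i ∈ I.erase k, sg (flip4 k e i) = ∏ i ∈ I.erase k, sg (e i) := by
      refine Finset.prod_congr rfl fun i hi => ?_
      rw [flip4, if_neg (Finset.ne_of_mem_erase hi)]
    rw [this]
    simp [flip4, sg_not]
  · rw [one_mul]
    refine Finset.prod_congr rfl fun i hi => ?_
    rw [flip4, if_neg]
    rintro rfl; exact h hi

lemma sum_flip (k : Fin 4) (f : (Fin 4 → Bool) → ℝ) : ∑ e, f (flip4 k e) = ∑ e, f e :=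
  Fintype.sum_bijective (flip4 k)
    (Function.Involutive.bijective (flip4_flip4 k)) _ _ (fun _ => rfl)

lemma chi_orth (e e' : Fin 4 → Bool) :
    ∑ I : Finset (Fin 4), chi I e * chi I e' = if e = e' then 16 else 0 := by
  have h1 : ∑ I : Finset (Fin 4), chi I e * chi I e' = ∏ i, (1 + sg (e i) * sg (e' i)) := by
    rw [Finset.prod_one_add, Finset.powerset_univ]
    refine Finset.sum_congr rfl fun I _ => ?_
    rw [chi, chi, Finset.prod_mul_distrib]
  rw [h1]
  split_ifs with h
  · subst h
    have : ∀ i, 1 + sg (e i) * sg (e i) = 2 := by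
      intro i; cases e i <;> norm_num [sg]
    simp only [this]; norm_num
  · obtain ⟨i, hi⟩ := Function.ne_iff.1 h
    apply Finset.prod_eq_zero (Finset.mem_univ i)
    revert hi
    cases e i <;> cases e' i <;> norm_num [sg]

lemma fourier (h : (Fin 4 → Bool) → ℝ)
    (hz : ∀ I : Finset (Fin 4), I.Nonempty → ∑ e, chi I e * h e = 0) (e : Fin 4 → Bool) :
    16 * h e = ∑ e', h e' := by
  have h1 : ∑ I : Finset (Fin 4), chi I e * ∑ e', chi I e' * h e' = 16 * h e := by
    simp only [Finset.mul_sum]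
    rw [Finset.sum_comm]
    have : ∀ e', ∑ I : Finset (Fin 4), chi I e * (chi I e' * h e') =
        if e = e' then 16 * h e' else 0 := by
      intro e'
      simp only [← mul_assoc]
      rw [← Finset.sum_mul, chi_orth]
      split_ifs <;> simp
    simp only [this]
    simp
  rw [← h1, Finset.sum_eq_single_of_mem ∅ (Finset.mem_univ _)]
  · simp [chi]
  · intro I _ hI
    rw [hz I (Finset.nonempty_iff_ne_empty.2 hI), mul_zero]

lemma sep_dec : ∀ e e' : Fin 4 → Bool, par e = false → par e' = false → e ≠ e' →
    ∀ k k', flip4 k e ≠ flip4 k' e' → ∃ i, i ≠ k ∧ i ≠ k' ∧ e i ≠ e' i := by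
  decide +kernel

lemma card_even : Fintype.card {e : Fin 4 → Bool // par e = false} = 8 := by decide +kernel

lemma matching (W : (Fin 4 → Bool) → Fin 4 → ℝ) (hW : ∀ e k, 0 ≤ W e k)
    (hf : ∀ e k, W (flip4 k e) k = W e k) (α : ℝ) (hα : 0 < α) (hs : ∀ e, ∑ k, W e k = α) :
    ∃ kk : {e : Fin 4 → Bool // par e = false} → Fin 4, (∀ e, 0 < W e.1 (kk e)) ∧
      Function.Injective fun e => flip4 (kk e) e.1 := by
  classical
  let t : {e : Fin 4 → Bool // par e = false} → Finset (Fin 4 → Bool) :=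
    fun e => univ.filter fun e' => ∃ k, 0 < W e.1 k ∧ e' = flip4 k e.1
  have hall : ∀ S : Finset {e : Fin 4 → Bool // par e = false}, S.card ≤ (S.biUnion t).card := by
    intro S
    have h1 : (S.card : ℝ) * α ≤ ((S.biUnion t).card : ℝ) * α := by
      calc (S.card : ℝ) * α = ∑ e ∈ S, ∑ k, W e.1 k := by
            simp [hs]
        _ = ∑ p ∈ S ×ˢ univ, W p.1.1 p.2 := by rw [Finset.sum_product]
        _ = ∑ p ∈ (S ×ˢ univ).filter (fun p => W p.1.1 p.2 ≠ 0), W p.1.1 p.2 := by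
            rw [Finset.sum_filter_ne_zero]
        _ = ∑ p ∈ (S ×ˢ univ).filter (fun p => W p.1.1 p.2 ≠ 0),
              W (flip4 p.2 p.1.1) p.2 := by
            refine Finset.sum_congr rfl fun p _ => (hf _ _).symm
        _ = ∑ p ∈ ((S ×ˢ univ).filter (fun p => W p.1.1 p.2 ≠ 0)).image
              (fun p => (flip4 p.2 p.1.1, p.2)), W p.1 p.2 := by
            rw [Finset.sum_image]
            rintro ⟨⟨a, ha⟩, k⟩ _ ⟨⟨b, hb⟩, k'⟩ _ hab
            simp only [Prod.mk.injEq] at hab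
            obtain ⟨h1, rfl⟩ := hab
            have := congrArg (flip4 k) h1
            rw [flip4_flip4, flip4_flip4] at this
            subst this; rfl
        _ ≤ ∑ p ∈ (S.biUnion t) ×ˢ univ, W p.1 p.2 := by
            refine Finset.sum_le_sum_of_subset_of_nonneg ?_ (fun p _ _ => hW _ _)
            intro p hp
            rw [Finset.mem_image] at hp
            obtain ⟨⟨a, k⟩, hak, rfl⟩ := hp
            rw [Finset.mem_filter, Finset.mem_product] at hak
            rw [Finset.mem_product]
            refine ⟨Finset.mem_biUnion.2 ⟨a, hak.1.1, ?_⟩, Finset.mem_univ _⟩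
            rw [Finset.mem_filter]
            exact ⟨Finset.mem_univ _, k, lt_of_le_of_ne (hW _ _) (Ne.symm hak.2), rfl⟩
        _ = ((S.biUnion t).card : ℝ) * α := by rw [Finset.sum_product]; simp [hs]
    exact_mod_cast le_of_mul_le_mul_right h1 hα
  obtain ⟨f, hfi, hft⟩ := (Finset.all_card_le_biUnion_card_iff_exists_injective t).1 hall
  have : ∀ e, ∃ k, 0 < W e.1 k ∧ f e = flip4 k e.1 := fun e => (Finset.mem_filter.1 (hft e)).2
  choose kk h1 h2 using this
  refine ⟨kk, h1, ?_⟩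
  have : (fun e => flip4 (kk e) e.1) = f := by funext e; exact (h2 e).symm
  rw [this]; exact hfi

variable {d : ℕ}

/-- How far the set lies on the positive side of a hyperplane. -/
noncomputable def pK (K : Set (EuclideanSpace ℝ (Fin d))) (u : EuclideanSpace ℝ (Fin d) × ℝ) : ℝ :=
  max 0 (sInf ((fun z => inner ℝ u.1 z - u.2) '' K))

lemma pK_nonneg (K : Set (EuclideanSpace ℝ (Fin d))) (u) : 0 ≤ pK K u := le_max_left _ _

lemma pK_cont {K : Set (EuclideanSpace ℝ (Fin d))} (hK : IsCompact K) : Continuous (pK K) := by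
  unfold pK
  refine continuous_const.max ?_
  refine IsCompact.continuous_sInf (f := fun (u : EuclideanSpace ℝ (Fin d) × ℝ) z =>
    inner ℝ u.1 z - u.2) hK ?_
  simp only [Function.HasUncurry.uncurry, id]
  fun_prop

lemma fcont (u : EuclideanSpace ℝ (Fin d) × ℝ) : Continuous fun z => inner ℝ u.1 z - u.2 := by
  fun_prop

lemma pK_pos {K : Set (EuclideanSpace ℝ (Fin d))} (hK : IsCompact K) {u} (h : 0 < pK K u) :
    ∀ z ∈ K, u.2 < inner ℝ u.1 z := by
  intro z hz
  have h1 : 0 < sInf ((fun z => inner ℝ u.1 z - u.2) '' K) := by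
    rcases lt_max_iff.1 h with h | h
    · exact absurd h (lt_irrefl _)
    · exact h
  have h2 : sInf ((fun z => inner ℝ u.1 z - u.2) '' K) ≤ inner ℝ u.1 z - u.2 :=
    csInf_le (hK.image (fcont u)).bddBelow ⟨z, hz, rfl⟩
  linarith

lemma pK_pos' {K : Set (EuclideanSpace ℝ (Fin d))} (hK : IsCompact K) (hn : K.Nonempty) {u}
    (h : ∀ z ∈ K, u.2 < inner ℝ u.1 z) : 0 < pK K u := by
  obtain ⟨z, hz, hzz⟩ := (hK.image (fcont u)).sInf_mem (hn.image _)
  refine lt_max_of_lt_right ?_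
  rw [← hzz]
  have := h z hz
  simp only; linarith

lemma pK_or {K : Set (EuclideanSpace ℝ (Fin d))} (hK : IsCompact K) (hn : K.Nonempty)
    (hc : Convex ℝ K) (u : EuclideanSpace ℝ (Fin d) × ℝ) (h : ¬ ∃ z ∈ K, inner ℝ u.1 z = u.2) :
    ∃ b, 0 < pK K (sg b • u) := by
  by_contra hcon
  push Not at hcon
  have h1 : ¬ ∀ z ∈ K, u.2 < inner ℝ u.1 z := by
    intro h'
    have := hcon false
    simp only [sg, Bool.false_eq_true, if_false, one_smul] at this
    exact absurd (pK_pos' hK hn h') (not_lt.2 this)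
  have h2 : ¬ ∀ z ∈ K, inner ℝ u.1 z < u.2 := by
    intro h'
    have := hcon true
    refine absurd (pK_pos' hK hn ?_) (not_lt.2 this)
    intro z hz
    simp only [sg, if_true, neg_smul, one_smul, Prod.snd_neg, Prod.fst_neg, inner_neg_left]
    linarith [h' z hz]
  push Not at h1 h2
  obtain ⟨y, hy, hy'⟩ := h1
  obtain ⟨z, hz, hz'⟩ := h2
  have hcont : ContinuousOn (fun z => inner ℝ u.1 z) K := by fun_prop
  obtain ⟨w, hw, hw'⟩ := hc.isPreconnected.intermediate_value hy hz hcont ⟨hy', hz'⟩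
  exact h ⟨w, hw, hw'⟩

/-- The weights. -/
noncomputable def WW (F : Finset (Set (EuclideanSpace ℝ (Fin d))))
    (u : Fin 4 → EuclideanSpace ℝ (Fin d) × ℝ) (e : Fin 4 → Bool) (k : Fin 4) : ℝ :=
  ∑ K ∈ F, ∏ i ∈ univ.erase k, pK K (sg (e i) • u i)

lemma WW_nonneg (F : Finset (Set (EuclideanSpace ℝ (Fin d)))) (u) (e) (k) : 0 ≤ WW F u e k :=
  Finset.sum_nonneg fun _ _ => Finset.prod_nonneg fun _ _ => pK_nonneg _ _

lemma WW_flip (F : Finset (Set (EuclideanSpace ℝ (Fin d)))) (u) (e) (k) :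
    WW F u (flip4 k e) k = WW F u e k := by
  refine Finset.sum_congr rfl fun K _ => Finset.prod_congr rfl fun i hi => ?_
  rw [flip4, if_neg (Finset.ne_of_mem_erase hi)]

lemma core (F : Finset (Set (EuclideanSpace ℝ (Fin d))))
    (hne : ∀ A ∈ F, A.Nonempty) (hcpt : ∀ A ∈ F, IsCompact A) (hcvx : ∀ A ∈ F, Convex ℝ A)
    (hdisj : ∀ G : Finset (Set (EuclideanSpace ℝ (Fin d))),
      G ⊆ F → G.card = 8 → ¬ (∀ A ∈ G, ∀ B ∈ G, A ≠ B → Disjoint A B))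
    (u : Fin 4 → EuclideanSpace ℝ (Fin d) × ℝ)
    (hz : ∀ I : Finset (Fin 4), 1 ≤ I.card → I.card ≤ 3 →
      ∑ e, chi I e * ∑ k, WW F u e k = 0) :
    ∀ A ∈ F, ∀ k, ∃ i, i ≠ k ∧ ∃ z ∈ A, inner ℝ (u i).1 z = (u i).2 := by
  classical
  have hfour : ∑ e, chi univ e * ∑ k, WW F u e k = 0 := by
    simp only [Finset.mul_sum]
    rw [Finset.sum_comm]
    refine Finset.sum_eq_zero fun k _ => ?_
    have h1 := sum_flip k (fun e => chi univ e * WW F u e k)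
    simp only [chi_flip, WW_flip, Finset.mem_univ, if_true, neg_mul, one_mul,
      Finset.sum_neg_distrib] at h1
    linarith
  have hconst := fourier (fun e => ∑ k, WW F u e k) (by
    intro I hI
    by_cases h3 : I.card ≤ 3
    · exact hz I (Finset.card_pos.2 hI) h3
    · have : I = univ := by
        rw [← Finset.card_eq_iff_eq_univ]
        have := Finset.card_le_univ I
        simp only [Fintype.card_fin] at this ⊢
        omega
      rw [this]; exact hfour)
  set α : ℝ := (∑ e, ∑ k, WW F u e k) / 16 with hαdef
  have hs : ∀ e, ∑ k, WW F u e k = α := by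
    intro e; have := hconst e; rw [hαdef, ← this]; ring
  have hα0 : 0 ≤ α := by
    rw [← hs (fun _ => false)]; exact Finset.sum_nonneg fun _ _ => WW_nonneg _ _ _ _
  rcases hα0.lt_or_eq with hα | hα
  · exfalso
    obtain ⟨kk, hk1, hk2⟩ := matching (WW F u) (WW_nonneg F u) (WW_flip F u) α hα hs
    have : ∀ e, ∃ K ∈ F, ∀ i, i ≠ kk e → 0 < pK K (sg (e.1 i) • u i) := by
      intro e
      obtain ⟨K, hK, hK'⟩ := Finset.exists_ne_zero_of_sum_ne_zero (hk1 e).ne'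
      refine ⟨K, hK, fun i hi => ?_⟩
      exact lt_of_le_of_ne (pK_nonneg _ _)
        (Ne.symm (Finset.prod_ne_zero_iff.1 hK' i (Finset.mem_erase.2 ⟨hi, Finset.mem_univ _⟩)))
    choose KK hKF hKp using this
    have hd : ∀ e e', e ≠ e' → Disjoint (KK e) (KK e') := by
      intro e e' hee
      obtain ⟨i, hi, hi', hne'⟩ := sep_dec e.1 e'.1 e.2 e'.2 (fun h => hee (Subtype.ext h))
        (kk e) (kk e') (fun h => hee (hk2 h))
      rw [Set.disjoint_left]
      intro z hz1 hz2
      have h1 := pK_pos (hcpt _ (hKF e)) (hKp e i hi) z hz1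
      have h2 := pK_pos (hcpt _ (hKF e')) (hKp e' i hi') z hz2
      revert hne' h1 h2
      cases e.1 i <;> cases e'.1 i <;> simp [sg, inner_neg_left] <;>
        intro h1 <;> linarith
    have hinj : Function.Injective KK := by
      intro e e' h
      by_contra hee
      have h1 := hd e e' hee
      rw [← h] at h1
      obtain ⟨z, hz'⟩ := hne _ (hKF e)
      exact Set.disjoint_left.1 h1 hz' hz'
    refine hdisj (univ.image KK) ?_ ?_ ?_
    · intro A hA
      obtain ⟨e, _, rfl⟩ := Finset.mem_image.1 hA
      exact hKF e
    · rw [Finset.card_image_of_injective _ hinj, Finset.card_univ, card_even]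
    · intro A hA B hB hAB
      obtain ⟨e, _, rfl⟩ := Finset.mem_image.1 hA
      obtain ⟨e', _, rfl⟩ := Finset.mem_image.1 hB
      exact hd e e' (fun h => hAB (by rw [h]))
  · intro A hA k
    by_contra hcon
    push Not at hcon
    have : ∀ i, ∃ b, i ≠ k → 0 < pK A (sg b • u i) := by
      intro i
      by_cases hi : i = k
      · exact ⟨true, fun h => absurd hi h⟩
      · obtain ⟨b, hb⟩ := pK_or (hcpt A hA) (hne A hA) (hcvx A hA) (u i) (by
          rintro ⟨z, hz, hzz⟩; exact hcon i hi z hz hzz)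
        exact ⟨b, fun _ => hb⟩
    choose e he using this
    have h1 : 0 < WW F u e k :=
      Finset.sum_pos' (fun _ _ => Finset.prod_nonneg fun _ _ => pK_nonneg _ _)
        ⟨A, hA, Finset.prod_pos fun i hi => he i (Finset.ne_of_mem_erase hi)⟩
    have h2 : WW F u e k ≤ ∑ k, WW F u e k :=
      Finset.single_le_sum (fun k _ => WW_nonneg F u e k) (Finset.mem_univ k)
    rw [hs e, ← hα] at h2
    linarith

/-- The affine function attached to block `i` of a point of the cube. -/
noncomputable def ub (x : Fin 4 × Fin d → ℝ) (i : Fin 4) : EuclideanSpace ℝ (Fin d) × ℝ :=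
  (WithLp.toLp 2 fun k => x (i, k), 1 - ‖fun k => x (i, k)‖)

lemma ub_cont (i : Fin 4) : Continuous fun x : Fin 4 × Fin d → ℝ => ub x i := by
  unfold ub
  fun_prop

lemma ub_neg (i j : Fin 4) (x : Fin 4 × Fin d → ℝ) (hx : ∀ c, |x c| ≤ 1)
    (hi : ∃ k, |x (i, k)| = 1) (e : Fin 4 → Bool) :
    sg (e j) • ub (negR i x) j = sg (flip4 i e j) • ub x j := by
  by_cases h : j = i
  · subst h
    have e1 : (fun k => negR j x (j, k)) = -(fun k => x (j, k)) := by
      funext k; simp [negR]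
    have hn : ‖fun k => x (j, k)‖ = 1 := by
      apply le_antisymm
      · refine (pi_norm_le_iff_of_nonneg zero_le_one).2 fun k => ?_
        rw [Real.norm_eq_abs]; exact hx _
      · obtain ⟨k, hk⟩ := hi
        rw [← hk, ← Real.norm_eq_abs]
        exact norm_le_pi_norm (fun k => x (j, k)) k
    have h1 : ub (negR j x) j = - ub x j := by
      unfold ub
      rw [e1, norm_neg, hn]
      simp
    rw [h1]
    simp [flip4, sg_not]
  · have e1 : (fun k => negR i x (j, k)) = (fun k => x (j, k)) := by
      funext k; simp [negR, h]
    have h1 : ub (negR i x) j = ub x j := by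
      unfold ub; rw [e1]
    rw [h1]; simp [flip4, h]

/-- The test functions. -/
noncomputable def gg (F : Finset (Set (EuclideanSpace ℝ (Fin d)))) (I : Finset (Fin 4))
    (x : Fin 4 × Fin d → ℝ) : ℝ := ∑ e, chi I e * ∑ k, WW F (ub x) e k

lemma gg_cont (F : Finset (Set (EuclideanSpace ℝ (Fin d)))) (hcpt : ∀ A ∈ F, IsCompact A)
    (I : Finset (Fin 4)) : Continuous (gg F I) := by
  unfold gg WW
  refine continuous_finsetSum _ fun e _ => continuous_const.mul ?_
  refine continuous_finsetSum _ fun k _ => continuous_finsetSum _ fun K hK => ?_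
  refine continuous_finsetProd _ fun i _ => ?_
  exact (pK_cont (hcpt K hK)).comp ((ub_cont i).const_smul (sg (e i)))

lemma gg_neg (F : Finset (Set (EuclideanSpace ℝ (Fin d)))) (I : Finset (Fin 4)) (i : Fin 4)
    (x : Fin 4 × Fin d → ℝ) (hx : ∀ c, |x c| ≤ 1) (hi : ∃ k, |x (i, k)| = 1) :
    gg F I (negR i x) = (if i ∈ I then -1 else 1) * gg F I x := by
  have h1 : ∀ e k, WW F (ub (negR i x)) e k = WW F (ub x) (flip4 i e) k := by
    intro e k
    unfold WW
    refine Finset.sum_congr rfl fun K _ => Finset.prod_congr rfl fun j _ => ?_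
    rw [ub_neg i j x hx hi e]
  unfold gg
  simp only [h1]
  rw [← sum_flip i (fun e => chi I e * ∑ k, WW F (ub (x)) (flip4 i e) k)]
  simp only [flip4_flip4, chi_flip]
  rw [Finset.mul_sum]
  refine Finset.sum_congr rfl fun e _ => ?_
  ring

end geom

lemma final (q t : ℕ) (ht1 : 1 ≤ t) (ht2 : t ≤ 2 ^ q)
    (m d : ℕ) (hm : m = 2 ^ (q + 1) - t) (hd : d = 7 * 2 ^ q - 2 * t)
    (F : Fin m → Finset (Set (EuclideanSpace ℝ (Fin d))))
    (hne : ∀ r, ∀ A ∈ F r, A.Nonempty)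
    (hcpt : ∀ r, ∀ A ∈ F r, IsCompact A)
    (hcvx : ∀ r, ∀ A ∈ F r, Convex ℝ A)
    (hdisj : ∀ r, ∀ G : Finset (Set (EuclideanSpace ℝ (Fin d))),
      G ⊆ F r → G.card = 8 →
        ¬ (∀ A ∈ G, ∀ B ∈ G, A ≠ B → Disjoint A B)) :
    ∃ (a : Fin 4 → EuclideanSpace ℝ (Fin d)) (b : Fin 4 → ℝ),
      (∀ i, a i ≠ 0) ∧
      ∀ k : Fin 4, ∀ r : Fin m, ∀ A ∈ F r, ∃ i, i ≠ k ∧ ∃ z ∈ A, inner ℝ (a i) z = b i := by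
  classical
  obtain ⟨b, hb, hco⟩ := exists_exponent q t ht1 ht2
  rw [← hd] at hb
  rw [← hm] at hco
  obtain ⟨x, hx, hzero⟩ := zero_exists
    (J := Fin m × {I : Finset (Fin 4) // 1 ≤ I.card ∧ I.card ≤ 3})
    (fun j => j.2.1) (fun j => gg (d := d) (F j.1) j.2.1) (fun j => gg_cont _ (hcpt j.1) _)
    (fun j i x hx hi => gg_neg _ _ i x hx hi) b hb (by
      rw [Fintype.prod_prod_type]
      simp only [prod_lin, Finset.prod_const, Finset.card_univ, Fintype.card_fin]
      exact hco)
  have hdpos : 0 < d := by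
    have : 0 < 2 ^ q := by positivity
    omega
  let v : EuclideanSpace ℝ (Fin d) := EuclideanSpace.single ⟨0, hdpos⟩ 1
  have hv : v ≠ 0 := by
    intro h
    have := congrArg (fun w : EuclideanSpace ℝ (Fin d) => w ⟨0, hdpos⟩) h
    simp [v] at this
  refine ⟨fun i => if (ub x i).1 = 0 then v else (ub x i).1, fun i => (ub x i).2, ?_, ?_⟩
  · intro i
    simp only
    split_ifs with h
    · exact hv
    · exact h
  · intro k r A hA
    obtain ⟨i, hi, z, hz, hzz⟩ := core (F r) (hne r) (hcpt r) (hcvx r) (hdisj r) (ub x)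
      (fun I h1 h2 => hzero (r, ⟨I, h1, h2⟩)) A hA k
    refine ⟨i, hi, z, hz, ?_⟩
    have h0 : (ub x i).1 ≠ 0 := by
      intro h
      rw [h, inner_zero_left] at hzz
      have h1 : (fun k => x (i, k)) = 0 := by
        funext k
        have := congrArg (fun w : EuclideanSpace ℝ (Fin d) => w k) h
        simpa [ub] using this
      simp only [ub, h1, norm_zero, sub_zero] at hzz
      exact zero_ne_one hzz
    simp only [if_neg h0]
    exact hzz


end HP

lemma miss_dec : ∀ i₁ i₂ i₃ : Fin 4, i₁ < i₂ → i₂ < i₃ →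
    ∃ k, ∀ i, i ≠ k → i = i₁ ∨ i = i₂ ∨ i = i₃ := by
  decide

theorem stmt_12 (q t : ℕ) (ht1 : 1 ≤ t) (ht2 : t ≤ 2 ^ q)
    (m d : ℕ) (hm : m = 2 ^ (q + 1) - t) (hd : d = 7 * 2 ^ q - 2 * t)
    (F : Fin m → Finset (Set (EuclideanSpace ℝ (Fin d))))
    (hne : ∀ r, ∀ A ∈ F r, A.Nonempty)
    (hcpt : ∀ r, ∀ A ∈ F r, IsCompact A)
    (hcvx : ∀ r, ∀ A ∈ F r, Convex ℝ A)
    -- no eight members of any single family are pairwise disjoint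
    (hdisj : ∀ r, ∀ G : Finset (Set (EuclideanSpace ℝ (Fin d))),
      G ⊆ F r → G.card = 8 →
        ¬ (∀ A ∈ G, ∀ B ∈ G, A ≠ B → Disjoint A B)) :
    ∃ (a : Fin 4 → EuclideanSpace ℝ (Fin d)) (b : Fin 4 → ℝ),
      (∀ i, a i ≠ 0) ∧
      ∀ i₁ i₂ i₃ : Fin 4, i₁ < i₂ → i₂ < i₃ → ∀ r : Fin m, ∀ A ∈ F r,
        ((hyperplane (a i₁) (b i₁) ∪ hyperplane (a i₂) (b i₂) ∪
          hyperplane (a i₃) (b i₃)) ∩ A).Nonempty := by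
  obtain ⟨a, b, ha, h⟩ := HP.final q t ht1 ht2 m d hm hd F hne hcpt hcvx hdisj
  refine ⟨a, b, ha, ?_⟩
  intro i₁ i₂ i₃ h12 h23 r A hA
  obtain ⟨k, hk⟩ := miss_dec i₁ i₂ i₃ h12 h23
  obtain ⟨i, hi, z, hz, hzz⟩ := h k r A hA
  refine ⟨z, ?_, hz⟩
  rcases hk i hi with rfl | rfl | rfl
  · exact Or.inl (Or.inl hzz)
  · exact Or.inl (Or.inr hzz)
  · exact Or.inr hzz
end
end
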